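/- arXiv:1610.05835 — 2 statements merged into one kernel-verified Lean document; each statement's English description precedes it below -/
import Mathlib

section
/- Let n ≥ 2, α > n, p = 2(n-1)/(n+α-2) and t = 2n/(n+α). Then for all nonnegative f ∈ L^p(∂B^n) and g ∈ L^t(B^n), one has ∫_{B^n} ∫_{∂B^n} g(x) f(y) |x−y|^{α−n} dy dx ≥ C_{e1}(n,α) ‖f‖_{L^p(∂B^n)} ‖g‖_{L^t(B^n)}, where C_{e1}(n,α) = (nω_n)^{−(n+α−2)/(2(n−1))} · ( ∫_{B^n} ( ∫_{∂B^n} |ξ−ζ|^{α−n} dζ )^{2n/(n−α)} dξ )^{(n−α)/(2n)}, and this constant is sharp. -/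
noncomputable section

open MeasureTheory Metric ENNReal

/-- `ℝ^n` with the Euclidean norm. -/
abbrev Eu (n : ℕ) : Type := EuclideanSpace ℝ (Fin n)

/-- The last coordinate `x_n` of a point `x ∈ ℝ^n`. -/
def lastCoord (n : ℕ) (x : Eu n) : ℝ :=
  if h : 0 < n then x ⟨n - 1, Nat.sub_lt h Nat.one_pos⟩ else 0

/-- The first coordinate `x_1` of a point `x ∈ ℝ^n`. -/
def firstCoord (n : ℕ) (x : Eu n) : ℝ :=
  if h : 0 < n then x ⟨0, h⟩ else 0

/-- The open upper half space `ℝ^n_+ = {x : x_n > 0}`. -/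
def upperHalf (n : ℕ) : Set (Eu n) := {x | 0 < lastCoord n x}

/-- The identification of `ℝ^{n-1}` with the boundary `∂ℝ^n_+ = {x : x_n = 0}`. -/
def emb (n : ℕ) (y : Eu (n - 1)) : Eu n :=
  (EuclideanSpace.equiv (Fin n) ℝ).symm fun i =>
    if h : (i : ℕ) < n - 1 then y ⟨i, h⟩ else 0

/-- The point `z^o = (0,…,0,-1) ∈ ℝ^n`. -/
def zo (n : ℕ) : Eu n :=
  (EuclideanSpace.equiv (Fin n) ℝ).symm fun i => if (i : ℕ) = n - 1 then -1 else 0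

/-- The point `x^o = (0,…,0,-2) ∈ ℝ^n`. -/
def xo (n : ℕ) : Eu n :=
  (EuclideanSpace.equiv (Fin n) ℝ).symm fun i => if (i : ℕ) = n - 1 then -2 else 0

/-- The surface measure on the sphere `∂B^n = {x : |x - z^o| = 1}`. -/
def surf (n : ℕ) : Measure (Eu n) :=
  Measure.map (fun p : sphere (0 : Eu n) 1 => zo n + (p : Eu n))
    (volume : Measure (Eu n)).toSphere

/-- Lebesgue measure restricted to the open unit ball `B^n` centered at `z^o`. -/
def ballM (n : ℕ) : Measure (Eu n) := (volume : Measure (Eu n)).restrict (ball (zo n) 1)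

/-- `ω_n`, the volume of the unit ball in `ℝ^n`. -/
def unitBallVol (n : ℕ) : ℝ := ((volume : Measure (Eu n)) (ball (0 : Eu n) 1)).toReal

/-- `(∫ F^r)^{1/r}` (in `ℝ≥0∞`) of a nonnegative function `F`, for an arbitrary
nonzero real exponent `r`. -/
def eLp {X : Type*} [MeasurableSpace X] (μ : Measure X) (f : X → ℝ) (r : ℝ) : ℝ≥0∞ :=
  (∫⁻ x, ENNReal.ofReal (f x) ^ r ∂μ) ^ (1 / r)

/-- `(∫ F^r)^{1/r}` (in `ℝ≥0∞`) of an `ℝ≥0∞`-valued function `F`. -/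
def eLpE {X : Type*} [MeasurableSpace X] (μ : Measure X) (F : X → ℝ≥0∞) (r : ℝ) : ℝ≥0∞ :=
  (∫⁻ x, F x ^ r ∂μ) ^ (1 / r)

/-- The real `L^r`-norm `(∫ |f|^r)^{1/r}`. -/
def rLp {X : Type*} [MeasurableSpace X] (μ : Measure X) (f : X → ℝ) (r : ℝ) : ℝ :=
  (∫ x, |f x| ^ r ∂μ) ^ (1 / r)

/-- The sharp constant `C_{e1}(n,α)`. -/
def Ce1 (n : ℕ) (α : ℝ) : ℝ :=
  ((n : ℝ) * unitBallVol n) ^ (-(((n : ℝ) + α - 2) / (2 * ((n : ℝ) - 1)))) *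
    (∫ ξ in ball (zo n) 1,
        (∫ ζ, ‖ξ - ζ‖ ^ (α - (n : ℝ)) ∂surf n) ^ (2 * (n : ℝ) / ((n : ℝ) - α))) ^
      (((n : ℝ) - α) / (2 * (n : ℝ)))

/-- The sharp constant `C_{e2}(n,α)`. -/
def Ce2 (n : ℕ) (α : ℝ) : ℝ :=
  ((n : ℝ) * unitBallVol n) ^ (-(((n : ℝ) + α - 4) / (2 * ((n : ℝ) - 1)))) *
    (∫ ξ in ball (zo n) 1,
        (∫ ζ, (1 - ‖ξ - zo n‖ ^ 2) * ‖ξ - ζ‖ ^ (-((n : ℝ) - α + 2)) ∂surf n) ^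
          (2 * (n : ℝ) / ((n : ℝ) - α))) ^ (((n : ℝ) - α) / (2 * (n : ℝ)))


namespace HLS
open Set Filter Topology
open scoped RealInnerProductSpace

variable {n : ℕ}

/-- unit sphere -/
abbrev Sph (n : ℕ) := sphere (0 : Eu n) 1

/-- surface measure on the unit sphere -/
abbrev sm (n : ℕ) : Measure (Sph n) := (volume : Measure (Eu n)).toSphere

/-- conformal weight -/
def cw (c x : Eu n) : ℝ := (‖c‖ ^ 2 - 1) / ‖x - c‖ ^ 2

/-- conformal inversion -/
def cinv (c x : Eu n) : Eu n := c + cw c x • (x - c)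

lemma cinv_eq_inversion (c x : Eu n) (hc : 1 < ‖c‖) :
    cinv c x = EuclideanGeometry.inversion c (Real.sqrt (‖c‖ ^ 2 - 1)) x := by
  have : 0 ≤ ‖c‖ ^ 2 - 1 := by nlinarith
  simp only [cinv, cw, EuclideanGeometry.inversion, div_pow, Real.sq_sqrt this, dist_eq_norm,
    vsub_eq_sub, vadd_eq_add]
  rw [add_comm]

lemma norm_sub_pos_of (c x : Eu n) (hc : 1 < ‖c‖) (hx : ‖x‖ ≤ 1) : 0 < ‖x - c‖ := by
  rw [norm_pos_iff, sub_ne_zero]; rintro rfl; linarith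

lemma cw_pos (c x : Eu n) (hc : 1 < ‖c‖) (hx : ‖x‖ ≤ 1) : 0 < cw c x := by
  have := norm_sub_pos_of c x hc hx
  have : 0 < ‖c‖ ^ 2 - 1 := by nlinarith
  unfold cw; positivity

lemma cinv_sub (c x : Eu n) : cinv c x - c = cw c x • (x - c) := by simp [cinv]

lemma cw_mul (c x : Eu n) (hc : 1 < ‖c‖) (hx : ‖x‖ ≤ 1) : cw c x * ‖x - c‖ ^ 2 = ‖c‖ ^ 2 - 1 := by
  have := norm_sub_pos_of c x hc hx
  unfold cw; field_simp

/-- `1 - |σ x|^2 = w(x) (1 - |x|^2)` -/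
lemma one_sub_cinv (c x : Eu n) (hc : 1 < ‖c‖) (hx : ‖x‖ ≤ 1) :
    1 - ‖cinv c x‖ ^ 2 = cw c x * (1 - ‖x‖ ^ 2) := by
  have h1 := cw_mul c x hc hx
  have h2 : ‖cinv c x‖ ^ 2 = ‖c‖ ^ 2 + 2 * (cw c x * inner ℝ c (x - c)) + cw c x ^ 2 * ‖x - c‖ ^ 2 := by
    rw [cinv, norm_add_sq_real, inner_smul_right, norm_smul, mul_pow, Real.norm_eq_abs, sq_abs]
  have h3 : ‖x‖ ^ 2 = ‖c‖ ^ 2 + 2 * inner ℝ c (x - c) + ‖x - c‖ ^ 2 := by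
    rw [← norm_add_sq_real]; simp
  rw [h2, h3]
  linear_combination (1 - cw c x) * h1

lemma cinv_norm_le (c x : Eu n) (hc : 1 < ‖c‖) (hx : ‖x‖ ≤ 1) : ‖cinv c x‖ ≤ 1 := by
  have h := one_sub_cinv c x hc hx
  have := cw_pos c x hc hx
  have h1 : 0 ≤ 1 - ‖x‖ ^ 2 := by nlinarith [norm_nonneg x]
  have : 0 ≤ 1 - ‖cinv c x‖ ^ 2 := by rw [h]; positivity
  nlinarith [norm_nonneg (cinv c x)]

lemma cinv_norm_lt (c x : Eu n) (hc : 1 < ‖c‖) (hx : ‖x‖ < 1) : ‖cinv c x‖ < 1 := by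
  have h := one_sub_cinv c x hc hx.le
  have := cw_pos c x hc hx.le
  have h1 : 0 < 1 - ‖x‖ ^ 2 := by nlinarith [norm_nonneg x]
  have : 0 < 1 - ‖cinv c x‖ ^ 2 := by rw [h]; positivity
  nlinarith [norm_nonneg (cinv c x)]

lemma cinv_norm_eq (c x : Eu n) (hc : 1 < ‖c‖) (hx : ‖x‖ = 1) : ‖cinv c x‖ = 1 := by
  have h := one_sub_cinv c x hc hx.le
  rw [hx] at h
  have : ‖cinv c x‖ ^ 2 = 1 := by linarith
  nlinarith [norm_nonneg (cinv c x)]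

lemma cw_cinv (c x : Eu n) (hc : 1 < ‖c‖) (hx : ‖x‖ ≤ 1) : cw c (cinv c x) = (cw c x)⁻¹ := by
  have h1 := cw_mul c x hc hx
  have h0 := norm_sub_pos_of c x hc hx
  have h2 := cw_pos c x hc hx
  rw [cw, cinv_sub, norm_smul, mul_pow, Real.norm_eq_abs, sq_abs, ← h1]
  field_simp

lemma cinv_cinv (c x : Eu n) (hc : 1 < ‖c‖) (hx : ‖x‖ ≤ 1) : cinv c (cinv c x) = x := by
  have h2 := cw_pos c x hc hx
  rw [cinv, cinv_sub, cw_cinv c x hc hx, smul_smul, inv_mul_cancel₀ h2.ne']; simp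

/-- key identity -/
lemma norm_cinv_sub (c x y : Eu n) (hc : 1 < ‖c‖) (hx : ‖x‖ ≤ 1) :
    ‖cinv c x - y‖ ^ 2 * (cw c x)⁻¹ - ‖x - y‖ ^ 2 =
      (‖x - c‖ ^ 2 - (‖c‖ ^ 2 - 1)) * (‖y - c‖ ^ 2 - (‖c‖ ^ 2 - 1)) / (‖c‖ ^ 2 - 1) := by
  have h0 := norm_sub_pos_of c x hc hx
  have h2 := cw_pos c x hc hx
  have hR : 0 < ‖c‖ ^ 2 - 1 := by nlinarith
  have e1 : cinv c x - y = cw c x • (x - c) - (y - c) := by rw [← cinv_sub]; abel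
  have e2 : x - y = (x - c) - (y - c) := by abel
  rw [e1, e2, norm_sub_sq_real (cw c x • (x - c)), norm_sub_sq_real (x - c) (y - c), norm_smul, inner_smul_left, mul_pow,
    Real.norm_eq_abs, sq_abs]
  simp only [cw, conj_trivial]
  field_simp
  ring

lemma norm_cinv_sub_cinv (c x y : Eu n) (hc : 1 < ‖c‖) (hx : ‖x‖ ≤ 1) (hy : ‖y‖ ≤ 1) :
    ‖cinv c x - cinv c y‖ ^ 2 = cw c x * cw c y * ‖x - y‖ ^ 2 := by
  have h0 := norm_sub_pos_of c x hc hx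
  have h0' := norm_sub_pos_of c y hc hy
  have e1 : cinv c x - cinv c y = cw c x • (x - c) - cw c y • (y - c) := by
    rw [← cinv_sub, ← cinv_sub]; abel
  have e2 : x - y = (x - c) - (y - c) := by abel
  rw [e1, e2, norm_sub_sq_real, norm_sub_sq_real, norm_smul, norm_smul, inner_smul_left,
    inner_smul_right, mul_pow, mul_pow,
    Real.norm_eq_abs, Real.norm_eq_abs, sq_abs, sq_abs]
  simp only [cw, conj_trivial]
  field_simp
  ring

/-- swap -/
lemma exists_swap (x z : Eu n) (hxz : ‖x‖ < ‖z‖) (hz : ‖z‖ < 1) :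
    ∃ c : Eu n, 1 < ‖c‖ ∧ cinv c x = z ∧ cw c x < 1 := by
  set u : ℝ := (1 - ‖x‖ ^ 2) / (‖z‖ ^ 2 - ‖x‖ ^ 2) with hu
  have hx0 := norm_nonneg x
  have hd : 0 < ‖z‖ ^ 2 - ‖x‖ ^ 2 := by nlinarith
  have hu1 : 1 < u := by rw [hu, one_lt_div hd]; nlinarith
  have hud : u * (‖z‖ ^ 2 - ‖x‖ ^ 2) = 1 - ‖x‖ ^ 2 := by rw [hu]; field_simp
  have hne : z - x ≠ 0 := by rw [sub_ne_zero]; rintro rfl; exact lt_irrefl _ hxz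
  have hpos : 0 < ‖z - x‖ := norm_pos_iff.2 hne
  set c := x + u • (z - x) with hcdef
  have h2 : ‖c‖ ^ 2 = ‖x‖ ^ 2 + 2 * (u * inner ℝ x (z - x)) + u ^ 2 * ‖z - x‖ ^ 2 := by
    rw [hcdef, norm_add_sq_real, inner_smul_right, norm_smul, mul_pow, Real.norm_eq_abs, sq_abs]
  have h3 : ‖z‖ ^ 2 = ‖x‖ ^ 2 + 2 * inner ℝ x (z - x) + ‖z - x‖ ^ 2 := by
    rw [← norm_add_sq_real]; simp
  have hR : ‖c‖ ^ 2 - 1 = u * (u - 1) * ‖z - x‖ ^ 2 := by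
    rw [h2]; rw [h3] at hud; linear_combination hud
  have hRpos : 0 < ‖c‖ ^ 2 - 1 := by
    rw [hR]; have : 0 < u - 1 := by linarith
    positivity
  have hxc : x - c = (-u) • (z - x) := by rw [hcdef]; simp
  have hw : cw c x = (u - 1) / u := by
    rw [cw, hxc, hR, norm_smul, mul_pow, Real.norm_eq_abs, sq_abs]
    field_simp
  refine ⟨c, by nlinarith [norm_nonneg c], ?_, ?_⟩
  · rw [cinv, hw, hxc, smul_smul, hcdef, add_assoc, ← add_smul]
    have : u + (u - 1) / u * -u = 1 := by field_simp; ring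
    rw [this]; simp
  · rw [hw, div_lt_one (by linarith)]; linarith

/-! ### Jacobian of the Lorentz reflection on the null cone -/

/-- null-cone parametrized Lorentz reflection -/
def lor (c z : Eu n) : Eu n := z - (2 * (inner ℝ c z - ‖z‖) / (‖c‖ ^ 2 - 1)) • c

lemma lor_norm (c z : Eu n) (hc : 1 < ‖c‖) :
    ‖lor c z‖ = ‖z‖ - 2 * (inner ℝ c z - ‖z‖) / (‖c‖ ^ 2 - 1) := by
  have hR : 0 < ‖c‖ ^ 2 - 1 := by nlinarith
  have hcz : inner ℝ c z ≤ ‖c‖ * ‖z‖ := real_inner_le_norm c z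
  have h0 : 0 ≤ ‖z‖ - 2 * (inner ℝ c z - ‖z‖) / (‖c‖ ^ 2 - 1) := by
    rw [sub_nonneg, div_le_iff₀ hR]
    nlinarith [norm_nonneg z, mul_nonneg (norm_nonneg z) (sq_nonneg (‖c‖ - 1))]
  rw [← sq_eq_sq₀ (norm_nonneg _) h0, lor, norm_sub_sq_real, norm_smul, inner_smul_right, mul_pow,
    Real.norm_eq_abs, sq_abs, real_inner_comm]
  field_simp
  ring

lemma lor_lor (c z : Eu n) (hc : 1 < ‖c‖) : lor c (lor c z) = z := by
  have hR : 0 < ‖c‖ ^ 2 - 1 := by nlinarith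
  have h1 : inner ℝ c (lor c z) - ‖lor c z‖ = -(inner ℝ c z - ‖z‖) := by
    rw [lor_norm c z hc, lor, inner_sub_right, inner_smul_right, real_inner_self_eq_norm_sq]
    field_simp
    ring
  conv_lhs => rw [lor]
  rw [h1, lor]
  simp only [mul_neg, neg_div, neg_smul]
  abel

lemma lor_zero (c : Eu n) : lor c 0 = 0 := by simp [lor]

lemma lor_ne_zero (c z : Eu n) (hc : 1 < ‖c‖) (hz : z ≠ 0) : lor c z ≠ 0 := by
  intro h; apply hz; rw [← lor_lor c z hc, h, lor_zero]

lemma lor_image (c : Eu n) (hc : 1 < ‖c‖) : lor c '' {0}ᶜ = {0}ᶜ := by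
  ext z
  simp only [mem_image, mem_compl_iff, mem_singleton_iff]
  exact ⟨fun ⟨x, hx, h⟩ => h ▸ lor_ne_zero c x hc hx,
    fun h => ⟨lor c z, lor_ne_zero c z hc h, lor_lor c z hc⟩⟩

lemma lor_smul (c z : Eu n) (r : ℝ) (hr : 0 ≤ r) : lor c (r • z) = r • lor c z := by
  simp only [lor, inner_smul_right, norm_smul, Real.norm_eq_abs, abs_of_nonneg hr, smul_sub,
    smul_smul]
  congr 2
  ring

lemma norm_lor_sph (c z : Eu n) (hc : 1 < ‖c‖) (hz : ‖z‖ = 1) : ‖lor c z‖ = (cw c z)⁻¹ := by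
  have hR : 0 < ‖c‖ ^ 2 - 1 := by nlinarith
  rw [lor_norm c z hc, cw, norm_sub_sq_real, hz, real_inner_comm]
  field_simp
  ring

lemma lor_sph (c z : Eu n) (hc : 1 < ‖c‖) (hz : ‖z‖ = 1) : cw c z • lor c z = cinv c z := by
  have hR : 0 < ‖c‖ ^ 2 - 1 := by nlinarith
  have h0 := norm_sub_pos_of c z hc hz.le
  have h1 : ‖z - c‖ ^ 2 = 1 - 2 * inner ℝ c z + ‖c‖ ^ 2 := by
    rw [norm_sub_sq_real, hz, real_inner_comm]; ring
  have e : (1 : ℝ) - cw c z = - (cw c z * (2 * (inner ℝ c z - 1) / (‖c‖ ^ 2 - 1))) := by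
    rw [cw]
    field_simp
    rw [h1]; ring
  have : cinv c z = cw c z • z + (1 - cw c z) • c := by rw [cinv]; module
  rw [this, e, lor, hz]
  module

lemma lor_hasFDerivAt (c z : Eu n) (hz : z ≠ 0) :
    HasFDerivAt (lor c)
      (ContinuousLinearMap.id ℝ (Eu n) - ((2 / (‖c‖ ^ 2 - 1)) •
        (innerSL ℝ c - ‖z‖⁻¹ • innerSL ℝ z)).smulRight c) z := by
  have hn : HasFDerivAt (fun z : Eu n => ‖z‖) (‖z‖⁻¹ • innerSL ℝ z) z := by
    have h1 := (hasStrictFDerivAt_norm_sq z).hasFDerivAt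
    have h2 := h1.sqrt (by simpa using hz)
    have h3 : (fun z : Eu n => ‖z‖) = fun z => Real.sqrt (‖z‖ ^ 2) := by
      funext z; rw [Real.sqrt_sq (norm_nonneg _)]
    rw [h3]
    refine h2.congr_fderiv ?_
    rw [Real.sqrt_sq (norm_nonneg _)]
    ext v
    simp
    field_simp
  have h1 : HasFDerivAt (fun z : Eu n => 2 / (‖c‖ ^ 2 - 1) * (inner ℝ c z - ‖z‖))
      ((2 / (‖c‖ ^ 2 - 1)) • (innerSL ℝ c - ‖z‖⁻¹ • innerSL ℝ z)) z :=
    ((innerSL ℝ c).hasFDerivAt.sub hn).const_mul _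
  have h2 := (hasFDerivAt_id z).sub (h1.smul_const c)
  refine h2.congr_of_eventuallyEq (Eventually.of_forall fun z => ?_)
  simp only [lor, id, Pi.sub_apply]
  congr 2
  ring

lemma lor_det (c z : Eu n) (hc : 1 < ‖c‖) (hz : z ≠ 0) :
    |(ContinuousLinearMap.id ℝ (Eu n) - ((2 / (‖c‖ ^ 2 - 1)) •
        (innerSL ℝ c - ‖z‖⁻¹ • innerSL ℝ z)).smulRight c).det| = ‖lor c z‖ / ‖z‖ := by
  have hR : 0 < ‖c‖ ^ 2 - 1 := by nlinarith
  have hz0 : 0 < ‖z‖ := norm_pos_iff.2 hz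
  set f : Eu n →L[ℝ] ℝ := (2 / (‖c‖ ^ 2 - 1)) • (innerSL ℝ c - ‖z‖⁻¹ • innerSL ℝ z) with hf
  have e : ((ContinuousLinearMap.id ℝ (Eu n) - f.smulRight c : Eu n →L[ℝ] Eu n) : Eu n →ₗ[ℝ] Eu n)
      = LinearMap.transvection (f : Eu n →ₗ[ℝ] ℝ) (-c) := by
    ext v
    simp [LinearMap.transvection, sub_eq_add_neg]
  rw [ContinuousLinearMap.det, e, LinearMap.transvection.det]
  have : 1 + (f : Eu n →ₗ[ℝ] ℝ) (-c) = - (‖lor c z‖ / ‖z‖) := by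
    rw [lor_norm c z hc]
    simp [hf]
    rw [real_inner_comm c z]
    field_simp
    ring
  rw [this, abs_neg, abs_of_nonneg (by positivity)]

lemma lintegral_polar (hn : 2 ≤ n) (F : Eu n → ℝ≥0∞) (hF : Measurable F) :
    ∫⁻ x in ({0}ᶜ : Set (Eu n)), F x = ∫⁻ θ, ∫⁻ r, F ((r : ℝ) • (θ : Eu n))
      ∂(Measure.volumeIoiPow (n - 1)) ∂(sm n) := by
  have h := (volume : Measure (Eu n)).measurePreserving_homeomorphUnitSphereProd
  have h2 := h.symm (homeomorphUnitSphereProd (Eu n)).toMeasurableEquiv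
  rw [← lintegral_subtype_comap (measurableSet_singleton _).compl]
  have h3 := h2.lintegral_comp (f := fun x : ({0}ᶜ : Set (Eu n)) => F x)
    (hF.comp measurable_subtype_coe)
  rw [← h3, lintegral_prod]
  · simp [finrank_euclideanSpace]
  · exact (hF.comp measurable_subtype_coe).comp_aemeasurable
      (homeomorphUnitSphereProd (Eu n)).toMeasurableEquiv.symm.measurable.aemeasurable

lemma lor_measurable (c : Eu n) : Measurable (lor c) := by
  unfold lor; fun_prop

lemma cinv_measurable (c : Eu n) : Measurable (cinv c) := by
  unfold cinv cw; fun_prop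

lemma cw_measurable (c : Eu n) : Measurable (cw c) := by
  unfold cw; fun_prop

lemma sphere_cv_aux (hn : 2 ≤ n) (c : Eu n) (hc : 1 < ‖c‖) (Ψ : Eu n → ℝ≥0∞) (hΨ : Measurable Ψ) :
    ∫⁻ θ, Ψ (cinv c θ) * ENNReal.ofReal (cw c θ ^ (n - 1)) ∂(sm n) = ∫⁻ θ, Ψ θ ∂(sm n) := by
  have hn0 : (0 : ℝ) < n := by positivity
  set F : Eu n → ℝ≥0∞ := fun x => Ψ (‖x‖⁻¹ • x) * (ball (0 : Eu n) 1).indicator 1 x with hF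
  have hFm : Measurable F := by
    refine Measurable.mul (hΨ.comp (by fun_prop)) ?_
    exact measurable_one.indicator measurableSet_ball
  have hIio : ∀ a : ℝ, ∀ ha : 0 < a, Measure.volumeIoiPow (n - 1) (Iio ⟨a, mem_Ioi.2 ha⟩)
      = ENNReal.ofReal (a ^ n / n) := by
    intro a ha
    rw [Measure.volumeIoiPow_apply_Iio]
    have : n - 1 + 1 = n := by omega
    simp only [this]
    congr 2
    rw [Nat.cast_sub (by omega)]; simp
  have key : ∀ a : ℝ, ∀ ha : 0 < a, ∀ C : ℝ≥0∞, ∫⁻ r : Ioi (0 : ℝ),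
      C * (Iio (⟨a, mem_Ioi.2 ha⟩ : Ioi (0 : ℝ))).indicator 1 r ∂(Measure.volumeIoiPow (n - 1))
      = C * ENNReal.ofReal (a ^ n / n) := by
    intro a ha C
    rw [lintegral_const_mul _ (measurable_one.indicator measurableSet_Iio),
      lintegral_indicator_one measurableSet_Iio, hIio a ha]
  have e1 : ∫⁻ x in ({0}ᶜ : Set (Eu n)), F x = ∫⁻ θ, Ψ θ * ENNReal.ofReal (1 / n) ∂(sm n) := by
    rw [lintegral_polar hn F hFm]
    refine lintegral_congr fun θ => ?_
    have := key 1 one_pos (Ψ θ)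
    rw [one_pow] at this
    rw [← this]
    refine lintegral_congr fun r => ?_
    have hr : (0 : ℝ) < r := r.2
    have hθ : ‖(θ : Eu n)‖ = 1 := by simpa using θ.2
    have e : ‖(r : ℝ) • (θ : Eu n)‖⁻¹ • ((r : ℝ) • (θ : Eu n)) = θ := by
      rw [norm_smul, hθ, Real.norm_eq_abs, abs_of_pos hr, smul_smul]
      simp [hr.ne']
    simp only [hF, e]
    congr 1
    simp only [indicator, mem_ball, dist_zero_right, norm_smul, hθ, Real.norm_eq_abs, abs_of_pos hr,
      mem_Iio, mul_one, ← Subtype.coe_lt_coe, Pi.one_apply]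
  have e2 : ∫⁻ x in ({0}ᶜ : Set (Eu n)), F x = ∫⁻ x in ({0}ᶜ : Set (Eu n)),
      ENNReal.ofReal (‖lor c x‖ / ‖x‖) * F (lor c x) := by
    conv_lhs => rw [← lor_image c hc]
    rw [lintegral_image_eq_lintegral_abs_det_fderiv_mul volume (measurableSet_singleton _).compl
      (fun x hx => (lor_hasFDerivAt c x hx).hasFDerivWithinAt)
      (fun x _ y _ hxy => by rw [← lor_lor c x hc, hxy, lor_lor c y hc])]
    refine setLIntegral_congr_fun (measurableSet_singleton _).compl fun x hx => ?_
    simp only []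
    rw [lor_det c x hc hx]
  have e3 : ∫⁻ x in ({0}ᶜ : Set (Eu n)), ENNReal.ofReal (‖lor c x‖ / ‖x‖) * F (lor c x)
      = ∫⁻ θ, Ψ (cinv c θ) * ENNReal.ofReal (cw c θ ^ (n - 1)) * ENNReal.ofReal (1 / n) ∂(sm n) := by
    have hm := lor_measurable c
    rw [lintegral_polar hn _ (by
      refine Measurable.mul ?_ (hFm.comp hm)
      fun_prop)]
    refine lintegral_congr fun θ => ?_
    have hθ : ‖(θ : Eu n)‖ = 1 := by simpa using θ.2
    have hw := cw_pos c θ hc hθ.le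
    have := key (cw c θ) hw (ENNReal.ofReal (cw c θ)⁻¹ * Ψ (cinv c θ))
    have e4 : Ψ (cinv c θ) * ENNReal.ofReal (cw c θ ^ (n - 1)) * ENNReal.ofReal (1 / n) =
        (ENNReal.ofReal (cw c θ)⁻¹ * Ψ (cinv c θ)) * ENNReal.ofReal (cw c θ ^ n / n) := by
      have : cw c θ ^ n = cw c θ ^ (n - 1) * cw c θ := by
        rw [← pow_succ]; congr 1; omega
      rw [this, mul_assoc, ← ENNReal.ofReal_mul (by positivity), mul_comm (ENNReal.ofReal _), mul_assoc,
        ← ENNReal.ofReal_mul (by positivity)]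
      congr 2
      field_simp
    rw [e4, ← this]
    refine lintegral_congr fun r => ?_
    have hr : (0 : ℝ) < r := r.2
    have e0 : ‖lor c ((r : ℝ) • (θ : Eu n))‖ = r * (cw c θ)⁻¹ := by
      rw [lor_smul c θ r hr.le, norm_smul, norm_lor_sph c θ hc hθ, Real.norm_eq_abs, abs_of_pos hr]
    have e5 : ‖lor c ((r : ℝ) • (θ : Eu n))‖⁻¹ • lor c ((r : ℝ) • (θ : Eu n)) = cinv c θ := by
      rw [e0, lor_smul c θ r hr.le, smul_smul, ← lor_sph c θ hc hθ]
      congr 1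
      field_simp
    simp only [hF]
    rw [e5, e0]
    rw [← mul_assoc]
    congr 1
    · congr 2
      rw [norm_smul, hθ, Real.norm_eq_abs, abs_of_pos hr]
      field_simp
    · have : (r : ℝ) * (cw c θ)⁻¹ < 1 ↔ (r : ℝ) < cw c θ := by
        rw [← div_eq_mul_inv, div_lt_one hw]
      simp only [indicator, mem_ball, dist_zero_right, e0, this, mem_Iio, ← Subtype.coe_lt_coe, Pi.one_apply]
  have e6 := e1.symm.trans (e2.trans e3)
  have hcm := cinv_measurable c
  have hwm := cw_measurable c
  rw [lintegral_mul_const _ (by fun_prop), lintegral_mul_const _ (by fun_prop)] at e6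
  have hpos : ENNReal.ofReal (1 / n) ≠ 0 := by
    simp; omega
  exact ((ENNReal.mul_left_inj hpos ENNReal.ofReal_ne_top).1 e6).symm

/-- inversion on the sphere -/
def sinv (c : Eu n) (hc : 1 < ‖c‖) (y : Sph n) : Sph n :=
  ⟨cinv c y, by simpa using cinv_norm_eq c y hc (by simpa using y.2)⟩

lemma sinv_measurable (c : Eu n) (hc : 1 < ‖c‖) : Measurable (sinv c hc) :=
  ((cinv_measurable c).comp measurable_subtype_coe).subtype_mk

lemma sinv_sinv (c : Eu n) (hc : 1 < ‖c‖) (y : Sph n) : sinv c hc (sinv c hc y) = y :=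
  Subtype.ext (cinv_cinv c y hc (by simpa using y.2.le))

/-- change of variables on the sphere -/
lemma sphere_cv (hn : 2 ≤ n) (c : Eu n) (hc : 1 < ‖c‖) :
    Measure.map (sinv c hc) ((sm n).withDensity fun θ => ENNReal.ofReal (cw c θ ^ (n - 1))) = sm n := by
  ext A hA
  rw [Measure.map_apply (sinv_measurable c hc) hA, withDensity_apply _ (sinv_measurable c hc hA),
    ← lintegral_indicator (sinv_measurable c hc hA)]
  have hA' : MeasurableSet ((↑) '' A : Set (Eu n)) :=
    (MeasurableEmbedding.subtype_coe (isClosed_sphere.measurableSet)).measurableSet_image.2 hA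
  have := sphere_cv_aux hn c hc (((↑) '' A : Set (Eu n)).indicator 1) (measurable_one.indicator hA')
  have e : ∀ y : Sph n, ((↑) '' A : Set (Eu n)).indicator (1 : Eu n → ℝ≥0∞) (y : Eu n) =
      A.indicator 1 y := by
    intro y
    have hy : (y : Eu n) ∈ ((↑) '' A : Set (Eu n)) ↔ y ∈ A := Subtype.val_injective.mem_set_image
    by_cases h : y ∈ A
    · rw [indicator_of_mem h, indicator_of_mem (hy.2 h)]; rfl
    · rw [indicator_of_notMem h, indicator_of_notMem (fun h' => h (hy.1 h'))]
  simp only [e] at this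
  rw [lintegral_indicator_one hA] at this
  rw [← this]
  refine lintegral_congr fun y => ?_
  have := e (sinv c hc y)
  simp only [sinv] at this
  rw [this]
  by_cases h : sinv c hc y ∈ A
  · have h2 : y ∈ sinv c hc ⁻¹' A := h
    rw [indicator_of_mem h2]
    simp only [sinv] at h
    rw [indicator_of_mem h]; simp
  · have h2 : y ∉ sinv c hc ⁻¹' A := h
    rw [indicator_of_notMem h2]
    simp only [sinv] at h
    rw [indicator_of_notMem h]; simp

lemma sphere_cv_integral (hn : 2 ≤ n) (c : Eu n) (hc : 1 < ‖c‖) (F : Sph n → ℝ) (hF : Measurable F) :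
    ∫ y, F (sinv c hc y) * cw c y ^ (n - 1) ∂(sm n) = ∫ y, F y ∂(sm n) := by
  conv_rhs => rw [← sphere_cv hn c hc]
  rw [integral_map (sinv_measurable c hc).aemeasurable hF.aestronglyMeasurable]
  simp only [ENNReal.ofReal]
  have hwm : Measurable fun θ : Sph n => cw c θ := (cw_measurable c).comp measurable_subtype_coe
  rw [integral_withDensity_eq_integral_smul (by fun_prop)]
  refine integral_congr_ae (Eventually.of_forall fun y => ?_)
  have hw := cw_pos c y hc (by simpa using y.2.le)
  simp only [NNReal.smul_def, smul_eq_mul]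
  rw [Real.coe_toNNReal _ (by positivity), mul_comm]

lemma ball_cv (c : Eu n) (hc : 1 < ‖c‖) (F : Eu n → ℝ) :
    ∫ x in ball (0 : Eu n) 1, F (cinv c x) * cw c x ^ n = ∫ x in ball (0 : Eu n) 1, F x := by
  have him : cinv c '' (ball (0 : Eu n) 1) = ball 0 1 := by
    ext z
    simp only [mem_image, mem_ball, dist_zero_right]
    exact ⟨fun ⟨x, hx, h⟩ => h ▸ cinv_norm_lt c x hc hx,
      fun h => ⟨cinv c z, cinv_norm_lt c z hc h, cinv_cinv c z hc h.le⟩⟩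
  conv_rhs => rw [← him]
  have hR : 0 ≤ ‖c‖ ^ 2 - 1 := by nlinarith
  have hfun : cinv c = EuclideanGeometry.inversion c (Real.sqrt (‖c‖ ^ 2 - 1)) := by
    funext x; exact cinv_eq_inversion c x hc
  rw [integral_image_eq_integral_abs_det_fderiv_smul volume measurableSet_ball
    (f' := fun x => ((Real.sqrt (‖c‖ ^ 2 - 1)) / dist x c) ^ 2 •
      ((ℝ ∙ (x - c))ᗮ.reflection : Eu n →L[ℝ] Eu n))
    (fun x hx => by
      rw [hfun]
      refine (EuclideanGeometry.hasFDerivAt_inversion ?_).hasFDerivWithinAt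
      rintro rfl
      simp at hx; linarith)
    (fun x hx y hy hxy => by
      simp at hx hy
      rw [← cinv_cinv c x hc hx.le, hxy, cinv_cinv c y hc hy.le])]
  refine setIntegral_congr_fun measurableSet_ball fun x hx => ?_
  simp at hx
  have hw := cw_pos c x hc hx.le
  have e1 : ((Real.sqrt (‖c‖ ^ 2 - 1)) / dist x c) ^ 2 = cw c x := by
    rw [div_pow, Real.sq_sqrt hR, dist_eq_norm]; rfl
  simp only [e1, ContinuousLinearMap.det, smul_eq_mul]
  have : |LinearMap.det ((cw c x • ((ℝ ∙ (x - c))ᗮ.reflection : Eu n →L[ℝ] Eu n) : Eu n →L[ℝ] Eu n) : Eu n →ₗ[ℝ] Eu n)| = cw c x ^ n := by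
    rw [ContinuousLinearMap.toLinearMap_smul, LinearMap.det_smul, finrank_euclideanSpace,
      Fintype.card_fin, abs_mul, abs_of_pos (by positivity : 0 < cw c x ^ n)]
    have h := Submodule.det_reflection (ℝ ∙ (x - c))ᗮ
    have h2 : LinearMap.det (((ℝ ∙ (x - c))ᗮ.reflection : Eu n →L[ℝ] Eu n) : Eu n →ₗ[ℝ] Eu n) =
      LinearMap.det (ℝ ∙ (x - c))ᗮ.reflection.toLinearMap := rfl
    rw [h2, h]
    simp
  rw [this, mul_comm]

/-- bounded measurable functions on the sphere -/
def Bd (u : Sph n → ℝ) : Prop := Measurable u ∧ ∃ C, ∀ y, |u y| ≤ C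

/-- bounded measurable functions on the sphere, bounded below by a positive constant -/
def Pb (u : Sph n → ℝ) : Prop := Bd u ∧ ∃ ε > 0, ∀ y, ε ≤ u y

lemma Pb.bd {u : Sph n → ℝ} (h : Pb u) : Bd u := h.1

lemma Pb.pos {u : Sph n → ℝ} (h : Pb u) (y : Sph n) : 0 < u y := by
  obtain ⟨_, ε, h1, h2⟩ := h
  exact h1.trans_le (h2 y)

lemma Bd.integrable {u : Sph n → ℝ} (h : Bd u) : Integrable u (sm n) := by
  obtain ⟨hm, C, hC⟩ := h
  exact Integrable.of_bound hm.aestronglyMeasurable C (ae_of_all _ hC)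

lemma Bd.mul {u v : Sph n → ℝ} (h : Bd u) (h' : Bd v) : Bd (fun y => u y * v y) := by
  obtain ⟨hm, C, hC⟩ := h
  obtain ⟨hm', C', hC'⟩ := h'
  refine ⟨hm.mul hm', C * C', fun y => ?_⟩
  rw [abs_mul]
  exact mul_le_mul (hC y) (hC' y) (abs_nonneg _) ((abs_nonneg _).trans (hC y))

lemma Bd.add {u v : Sph n → ℝ} (h : Bd u) (h' : Bd v) : Bd (fun y => u y + v y) := by
  obtain ⟨hm, C, hC⟩ := h
  obtain ⟨hm', C', hC'⟩ := h'
  exact ⟨hm.add hm', C + C', fun y => (abs_add_le _ _).trans (add_le_add (hC y) (hC' y))⟩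

lemma Bd.sub {u v : Sph n → ℝ} (h : Bd u) (h' : Bd v) : Bd (fun y => u y - v y) := by
  obtain ⟨hm, C, hC⟩ := h
  obtain ⟨hm', C', hC'⟩ := h'
  exact ⟨hm.sub hm', C + C', fun y => (abs_sub _ _).trans (add_le_add (hC y) (hC' y))⟩

lemma Bd.of_continuous {u : Sph n → ℝ} (h : Continuous u) : Bd u := by
  refine ⟨h.measurable, ?_⟩
  obtain ⟨C, hC⟩ := isCompact_univ.exists_bound_of_continuousOn (h.continuousOn (s := univ))
  exact ⟨C, fun y => hC y (mem_univ _)⟩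

lemma nsph (y : Sph n) : ‖(y : Eu n)‖ = 1 := by simp

/-- kernel -/
def ker (a : ℝ) (x y : Eu n) : ℝ := (‖x - y‖ ^ 2) ^ a

lemma ker_continuous {a : ℝ} (ha : 0 < a) : Continuous fun z : Eu n × Eu n => ker a z.1 z.2 := by
  unfold ker
  exact (by fun_prop : Continuous fun z : Eu n × Eu n => ‖z.1 - z.2‖ ^ 2).rpow_const
    (fun _ => Or.inr ha.le)

lemma ker_nonneg (a : ℝ) (x y : Eu n) : 0 ≤ ker a x y := by unfold ker; positivity

lemma ker_bd {a : ℝ} (ha : 0 < a) (x : Eu n) : Bd (fun y : Sph n => ker a x y) := by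
  have h1 : Continuous fun y : Sph n => ((x, (y : Eu n)) : Eu n × Eu n) :=
    continuous_const.prodMk continuous_subtype_val
  have h2 := (ker_continuous (n := n) ha).comp h1
  exact Bd.of_continuous h2

/-- extension operator -/
def J (a : ℝ) (u : Sph n → ℝ) (x : Eu n) : ℝ := ∫ y, u y * ker a x y ∂(sm n)

lemma J_add {a : ℝ} (ha : 0 < a) {u v : Sph n → ℝ} (hu : Bd u) (hv : Bd v) (x : Eu n) :
    J a (fun y => u y + v y) x = J a u x + J a v x := by
  unfold J
  rw [← integral_add (hu.mul (ker_bd ha x)).integrable (hv.mul (ker_bd ha x)).integrable]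
  simp only [add_mul]

lemma cw_cont (c : Eu n) (hc : 1 < ‖c‖) : Continuous fun y : Sph n => cw c (y : Eu n) := by
  unfold cw
  refine continuous_const.div (by fun_prop) fun y => ?_
  have := norm_sub_pos_of c y hc (nsph y).le
  positivity

lemma cwb_cont (c : Eu n) (hc : 1 < ‖c‖) (b : ℝ) :
    Continuous fun y : Sph n => cw c (y : Eu n) ^ b :=
  (cw_cont c hc).rpow_const fun y => Or.inl (cw_pos c y hc (nsph y).le).ne'

/-- conformal transform -/
def fs (a : ℝ) (c : Eu n) (hc : 1 < ‖c‖) (u : Sph n → ℝ) (y : Sph n) : ℝ :=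
  u (sinv c hc y) * cw c (y : Eu n) ^ ((n : ℝ) - 1 + a)

lemma Bd.fs {u : Sph n → ℝ} (h : Bd u) (a : ℝ) (c : Eu n) (hc : 1 < ‖c‖) : Bd (fs a c hc u) := by
  refine Bd.mul (u := fun y => u (sinv c hc y)) ?_ (Bd.of_continuous (cwb_cont c hc _))
  obtain ⟨hm, C, hC⟩ := h
  exact ⟨hm.comp (sinv_measurable c hc), C, fun y => hC _⟩

lemma Pb.fs {u : Sph n → ℝ} (h : Pb u) (a : ℝ) (c : Eu n) (hc : 1 < ‖c‖) : Pb (fs a c hc u) := by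
  refine ⟨h.1.fs a c hc, ?_⟩
  obtain ⟨_, ε, h1, h2⟩ := h
  obtain ⟨_, C, hC⟩ := Bd.of_continuous (cwb_cont c hc (-((n : ℝ) - 1 + a)))
  refine ⟨ε * (|C| + 1)⁻¹, by positivity, fun y => ?_⟩
  refine mul_le_mul (h2 _) ?_ (by positivity) (h1.le.trans (h2 _))
  have hw := cw_pos c y hc (nsph y).le
  rw [inv_le_comm₀ (by positivity) (by positivity), ← Real.rpow_neg hw.le]
  have := hC y
  have h3 := le_abs_self C
  have h4 := le_abs_self (cw c (y : Eu n) ^ (-((n : ℝ) - 1 + a)))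
  linarith

lemma cw_sinv (c : Eu n) (hc : 1 < ‖c‖) (y : Sph n) :
    cw c (sinv c hc y : Eu n) = (cw c (y : Eu n))⁻¹ := cw_cinv c y hc (nsph y).le

lemma fs_fs (a : ℝ) (c : Eu n) (hc : 1 < ‖c‖) (u : Sph n → ℝ) : fs a c hc (fs a c hc u) = u := by
  funext y
  have hw := cw_pos c y hc (nsph y).le
  unfold fs
  rw [sinv_sinv, cw_sinv, Real.inv_rpow hw.le, mul_assoc, inv_mul_cancel₀ (by positivity), mul_one]

lemma J_fs (hn : 2 ≤ n) {a : ℝ} (ha : 0 < a) (c : Eu n) (hc : 1 < ‖c‖) {u : Sph n → ℝ} (hu : Bd u)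
    (x : Eu n) (hx : ‖x‖ ≤ 1) : J a u (cinv c x) = cw c x ^ a * J a (fs a c hc u) x := by
  unfold J
  rw [← sphere_cv_integral hn c hc _ (hu.mul (ker_bd ha (cinv c x))).1, ← integral_const_mul]
  refine integral_congr_ae (ae_of_all _ fun y => ?_)
  have hw := cw_pos c y hc (nsph y).le
  have hw2 := cw_pos c x hc hx
  have e : ker a (cinv c x) (sinv c hc y : Eu n) = cw c x ^ a * cw c (y : Eu n) ^ a * ker a x y := by
    unfold ker sinv
    simp only
    rw [norm_cinv_sub_cinv c x y hc hx (nsph y).le, Real.mul_rpow (by positivity) (by positivity),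
      Real.mul_rpow (by positivity) (by positivity)]
  simp only [e, fs]
  rw [Real.rpow_add hw]
  have : cw c (y : Eu n) ^ (n - 1) = cw c (y : Eu n) ^ ((n : ℝ) - 1) := by
    rw [← Real.rpow_natCast, Nat.cast_sub (by omega)]; simp
  rw [this]; ring

/-- reflected kernel -/
def ker2 (a : ℝ) (c x y : Eu n) : ℝ := (‖cinv c x - y‖ ^ 2 * (cw c x)⁻¹) ^ a

lemma ker2_eq {a : ℝ} (c x y : Eu n) (hc : 1 < ‖c‖) (hx : ‖x‖ ≤ 1) :
    ker2 a c x y = (cw c x ^ a)⁻¹ * ker a (cinv c x) y := by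
  have hw2 := cw_pos c x hc hx
  unfold ker2 ker
  rw [Real.mul_rpow (by positivity) (by positivity), Real.inv_rpow hw2.le, mul_comm]

lemma J_ker2 (hn : 2 ≤ n) {a : ℝ} (ha : 0 < a) (c : Eu n) (hc : 1 < ‖c‖) {u : Sph n → ℝ} (hu : Bd u)
    (x : Eu n) (hx : ‖x‖ ≤ 1) : J a u x = ∫ y, fs a c hc u y * ker2 a c x y ∂(sm n) := by
  have h := J_fs hn ha c hc (hu.fs a c hc) x hx
  rw [fs_fs] at h
  have hw2 := cw_pos c x hc hx
  have h2 : J a u x = (cw c x ^ a)⁻¹ * J a (fs a c hc u) (cinv c x) := by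
    rw [h]; field_simp
  rw [h2]; unfold J
  rw [← integral_const_mul]
  refine integral_congr_ae (ae_of_all _ fun y => ?_)
  simp only
  rw [ker2_eq c x y hc hx]; ring

lemma ker2_bd {a : ℝ} (ha : 0 < a) (c : Eu n) (hc : 1 < ‖c‖) (x : Eu n) (hx : ‖x‖ ≤ 1) :
    Bd (fun y : Sph n => ker2 a c x y) := by
  simp only [ker2_eq c x _ hc hx]
  exact (Bd.of_continuous continuous_const).mul (ker_bd ha _)

lemma J_diff (hn : 2 ≤ n) {a : ℝ} (ha : 0 < a) (c : Eu n) (hc : 1 < ‖c‖) {u v : Sph n → ℝ} (hu : Bd u)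
    (hv : Bd v) (h : ∀ y, u y + fs a c hc u y = v y + fs a c hc v y)
    (x : Eu n) (hx : ‖x‖ ≤ 1) :
    J a u x - J a v x = 1 / 2 * ∫ y, (u y - v y) * (ker a x y - ker2 a c x y) ∂(sm n) := by
  have k1 := ker_bd ha x
  have k2 := ker2_bd ha c hc x hx
  have e1 : J a u x - J a v x = ∫ y, (u y - v y) * ker a x y ∂(sm n) := by
    unfold J
    rw [← integral_sub (hu.mul k1).integrable (hv.mul k1).integrable]
    simp only [sub_mul]
  have e2 : J a u x - J a v x = - ∫ y, (u y - v y) * ker2 a c x y ∂(sm n) := by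
    rw [J_ker2 hn ha c hc hu x hx, J_ker2 hn ha c hc hv x hx,
      ← integral_sub ((hu.fs a c hc).mul k2).integrable ((hv.fs a c hc).mul k2).integrable, ← integral_neg]
    refine integral_congr_ae (ae_of_all _ fun y => ?_)
    have := h y
    simp only
    rw [← sub_mul, ← neg_mul]
    congr 1; linarith
  simp only [mul_sub]
  rw [integral_sub ((hu.sub hv).mul k1).integrable ((hu.sub hv).mul k2).integrable]
  linarith

lemma cw_le_one_iff (c x : Eu n) (hc : 1 < ‖c‖) (hx : ‖x‖ ≤ 1) :
    cw c x ≤ 1 ↔ 0 ≤ ‖x - c‖ ^ 2 - (‖c‖ ^ 2 - 1) := by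
  have h0 := norm_sub_pos_of c x hc hx
  unfold cw
  rw [div_le_one (by positivity), sub_nonneg]

lemma one_le_cw_iff (c x : Eu n) (hc : 1 < ‖c‖) (hx : ‖x‖ ≤ 1) :
    1 ≤ cw c x ↔ ‖x - c‖ ^ 2 - (‖c‖ ^ 2 - 1) ≤ 0 := by
  have h0 := norm_sub_pos_of c x hc hx
  unfold cw
  rw [one_le_div (by positivity), sub_nonpos]

lemma ker_le_ker2 {a : ℝ} (ha : 0 < a) (c : Eu n) (hc : 1 < ‖c‖) (x : Eu n) (hx : ‖x‖ ≤ 1) (y : Sph n)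
    (hwx : cw c x ≤ 1) (hwy : cw c (y : Eu n) ≤ 1) : ker a x y ≤ ker2 a c x y := by
  have h := norm_cinv_sub c x y hc hx
  have hR : 0 < ‖c‖ ^ 2 - 1 := by nlinarith
  rw [cw_le_one_iff c x hc hx] at hwx
  rw [cw_le_one_iff c y hc (nsph y).le] at hwy
  refine Real.rpow_le_rpow (by positivity) ?_ ha.le
  have : 0 ≤ (‖x - c‖ ^ 2 - (‖c‖ ^ 2 - 1)) * (‖(y : Eu n) - c‖ ^ 2 - (‖c‖ ^ 2 - 1)) / (‖c‖ ^ 2 - 1) := by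
    positivity
  linarith

lemma ker2_le_ker {a : ℝ} (ha : 0 < a) (c : Eu n) (hc : 1 < ‖c‖) (x : Eu n) (hx : ‖x‖ ≤ 1) (y : Sph n)
    (hwx : cw c x ≤ 1) (hwy : 1 ≤ cw c (y : Eu n)) : ker2 a c x y ≤ ker a x y := by
  have h := norm_cinv_sub c x y hc hx
  have hR : 0 < ‖c‖ ^ 2 - 1 := by nlinarith
  have hw := cw_pos c x hc hx
  rw [cw_le_one_iff c x hc hx] at hwx
  rw [one_le_cw_iff c y hc (nsph y).le] at hwy
  refine Real.rpow_le_rpow (by positivity) ?_ ha.le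
  have : (‖x - c‖ ^ 2 - (‖c‖ ^ 2 - 1)) * (‖(y : Eu n) - c‖ ^ 2 - (‖c‖ ^ 2 - 1)) / (‖c‖ ^ 2 - 1) ≤ 0 :=
    div_nonpos_of_nonpos_of_nonneg (mul_nonpos_of_nonneg_of_nonpos hwx hwy) hR.le
  linarith

lemma ker_ne_ker2 {a : ℝ} (ha : 0 < a) (c : Eu n) (hc : 1 < ‖c‖) (y : Sph n)
    (hwy : cw c (y : Eu n) ≠ 1) : ker a (0 : Eu n) y - ker2 a c 0 y ≠ 0 := by
  have h0 : ‖(0 : Eu n)‖ ≤ 1 := by simp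
  have h := norm_cinv_sub c 0 y hc h0
  have hR : 0 < ‖c‖ ^ 2 - 1 := by nlinarith
  have hw := cw_pos c 0 hc h0
  intro h3
  have h4 : ‖cinv c 0 - y‖ ^ 2 * (cw c 0)⁻¹ = ‖(0 : Eu n) - y‖ ^ 2 := by
    rw [sub_eq_zero] at h3
    exact (Real.rpow_left_inj (by positivity) (by positivity) ha.ne').1 h3.symm
  rw [h4, sub_self] at h
  have h5 := (div_eq_zero_iff.1 h.symm).resolve_right hR.ne'
  apply hwy
  rcases mul_eq_zero.1 h5 with h6 | h6
  · simp at h6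
  · exact le_antisymm ((cw_le_one_iff c y hc (nsph y).le).2 h6.ge)
      ((one_le_cw_iff c y hc (nsph y).le).2 h6.le)

lemma sinv_eq_self (c : Eu n) (hc : 1 < ‖c‖) (y : Sph n) (hwy : cw c (y : Eu n) = 1) :
    sinv c hc y = y := by
  apply Subtype.ext
  simp [sinv, cinv, hwy]

open Classical in
/-- conformal polarization -/
def pol (a : ℝ) (c : Eu n) (hc : 1 < ‖c‖) (u : Sph n → ℝ) (y : Sph n) : ℝ :=
  if cw c (y : Eu n) ≤ 1 then max (u y) (fs a c hc u y) else min (u y) (fs a c hc u y)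

lemma fs_eq_self (a : ℝ) (c : Eu n) (hc : 1 < ‖c‖) (u : Sph n → ℝ) (y : Sph n)
    (hwy : cw c (y : Eu n) = 1) : fs a c hc u y = u y := by
  simp [fs, sinv_eq_self c hc y hwy, hwy]

/-- the pair (pol, fs pol) is a permutation of (u, fs u) -/
lemma pol_pair (a : ℝ) (c : Eu n) (hc : 1 < ‖c‖) (u : Sph n → ℝ) (y : Sph n) :
    (pol a c hc u y = u y ∧ fs a c hc (pol a c hc u) y = fs a c hc u y) ∨
    (pol a c hc u y = fs a c hc u y ∧ fs a c hc (pol a c hc u) y = u y) := by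
  have hw := cw_pos c y hc (nsph y).le
  have hB : 0 < cw c (y : Eu n) ^ ((n : ℝ) - 1 + a) := by positivity
  have e1 : fs a c hc u y = u (sinv c hc y) * cw c (y : Eu n) ^ ((n : ℝ) - 1 + a) := rfl
  have e2 : fs a c hc u (sinv c hc y) * cw c (y : Eu n) ^ ((n : ℝ) - 1 + a) = u y :=
    congrFun (fs_fs a c hc u) y
  have e3 : fs a c hc (pol a c hc u) y = if 1 ≤ cw c (y : Eu n) then max (fs a c hc u y) (u y)
      else min (fs a c hc u y) (u y) := by
    conv_lhs => unfold fs
    unfold pol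
    rw [cw_sinv]
    simp only [inv_le_one₀ hw]
    split_ifs
    · rw [max_mul_of_nonneg _ _ hB.le, e2, ← e1]
    · rw [min_mul_of_nonneg _ _ hB.le, e2, ← e1]
  rw [e3]
  unfold pol
  rcases lt_trichotomy (cw c (y : Eu n)) 1 with h | h | h
  · rw [if_pos h.le, if_neg h.not_ge]
    rcases le_total (u y) (fs a c hc u y) with h' | h'
    · right; simp [h']
    · left; simp [h']
  · left
    simp [fs_eq_self a c hc u y h]
  · rw [if_neg h.not_ge, if_pos h.le]
    rcases le_total (u y) (fs a c hc u y) with h' | h'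
    · left; simp [h']
    · right; simp [h']

lemma pol_sum (a : ℝ) (c : Eu n) (hc : 1 < ‖c‖) (u : Sph n → ℝ) (y : Sph n) :
    pol a c hc u y + fs a c hc (pol a c hc u) y = u y + fs a c hc u y := by
  rcases pol_pair a c hc u y with ⟨h, h'⟩ | ⟨h, h'⟩ <;> rw [h, h']; ring

lemma pol_measurable (a : ℝ) (c : Eu n) (hc : 1 < ‖c‖) {u : Sph n → ℝ} (hu : Bd u) :
    Measurable (pol a c hc u) := by
  have := (hu.fs a c hc).1
  exact Measurable.ite (measurableSet_le (cw_cont c hc).measurable measurable_const)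
    (hu.1.max this) (hu.1.min this)

lemma pol_bounds (hn : 2 ≤ n) {a : ℝ} (ha : 0 < a) (c : Eu n) (hc : 1 < ‖c‖) {u : Sph n → ℝ} {ε N : ℝ}
    (hε : 0 < ε) (h : ∀ y, ε ≤ u y ∧ u y ≤ N) (y : Sph n) :
    ε ≤ pol a c hc u y ∧ pol a c hc u y ≤ N := by
  have hw := cw_pos c y hc (nsph y).le
  have hb : 0 ≤ (n : ℝ) - 1 + a := by
    have : (2 : ℝ) ≤ n := by exact_mod_cast hn
    linarith
  have h1 := h y
  have h2 := h (sinv c hc y)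
  unfold pol
  split_ifs with hy
  · refine ⟨le_max_of_le_left h1.1, max_le h1.2 ?_⟩
    have : cw c (y : Eu n) ^ ((n : ℝ) - 1 + a) ≤ 1 := Real.rpow_le_one hw.le hy hb
    unfold fs
    nlinarith
  · refine ⟨le_min h1.1 ?_, min_le_of_left_le h1.2⟩
    have : 1 ≤ cw c (y : Eu n) ^ ((n : ℝ) - 1 + a) := Real.one_le_rpow (not_le.1 hy).le hb
    unfold fs
    nlinarith

lemma Pb.of_bounds {u : Sph n → ℝ} {ε N : ℝ} (hm : Measurable u) (hε : 0 < ε)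
    (h : ∀ y, ε ≤ u y ∧ u y ≤ N) : Pb u := by
  refine ⟨⟨hm, N, fun y => ?_⟩, ε, hε, fun y => (h y).1⟩
  rw [abs_of_pos (hε.trans_le (h y).1)]
  exact (h y).2

lemma pol_pb (hn : 2 ≤ n) {a : ℝ} (ha : 0 < a) (c : Eu n) (hc : 1 < ‖c‖) {u : Sph n → ℝ} (hu : Pb u) :
    Pb (pol a c hc u) := by
  obtain ⟨⟨hm, N, hN⟩, ε, hε, h⟩ := hu
  exact Pb.of_bounds (pol_measurable a c hc ⟨hm, N, hN⟩) hε
    (pol_bounds hn ha c hc hε fun y => ⟨h y, (le_abs_self _).trans (hN y)⟩)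

/-- sign of the integrand -/
lemma pol_sign {a : ℝ} (ha : 0 < a) (c : Eu n) (hc : 1 < ‖c‖) (u : Sph n → ℝ)
    (x : Eu n) (hx : ‖x‖ ≤ 1) (hwx : cw c x ≤ 1) (y : Sph n) (h : ℝ) (hh : h = u y ∨ h = fs a c hc u y) :
    (pol a c hc u y - h) * (ker a x y - ker2 a c x y) ≤ 0 := by
  unfold pol
  split_ifs with hy
  · have h1 := ker_le_ker2 ha c hc x hx y hwx hy
    refine mul_nonpos_of_nonneg_of_nonpos ?_ (by linarith)
    rcases hh with rfl | rfl <;> simp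
  · have h1 := ker2_le_ker ha c hc x hx y hwx (not_le.1 hy).le
    refine mul_nonpos_of_nonpos_of_nonneg ?_ (by linarith)
    rcases hh with rfl | rfl <;> simp

lemma J_pol_le (hn : 2 ≤ n) {a : ℝ} (ha : 0 < a) (c : Eu n) (hc : 1 < ‖c‖) {u : Sph n → ℝ} (hu : Pb u)
    (x : Eu n) (hx : ‖x‖ ≤ 1) (hwx : cw c x ≤ 1) : J a (pol a c hc u) x ≤ J a u x := by
  have h := J_diff hn ha c hc (pol_pb hn ha c hc hu).bd hu.bd (pol_sum a c hc u) x hx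
  have : ∫ y, (pol a c hc u y - u y) * (ker a x y - ker2 a c x y) ∂(sm n) ≤ 0 :=
    integral_nonpos fun y => pol_sign ha c hc u x hx hwx y _ (Or.inl rfl)
  linarith

lemma J_pol_le' (hn : 2 ≤ n) {a : ℝ} (ha : 0 < a) (c : Eu n) (hc : 1 < ‖c‖) {u : Sph n → ℝ} (hu : Pb u)
    (x : Eu n) (hx : ‖x‖ ≤ 1) (hwx : cw c x ≤ 1) : J a (pol a c hc u) x ≤ J a (fs a c hc u) x := by
  have h := J_diff hn ha c hc (pol_pb hn ha c hc hu).bd (hu.fs a c hc).bd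
    (fun y => by rw [pol_sum a c hc u, fs_fs, add_comm]) x hx
  have : ∫ y, (pol a c hc u y - fs a c hc u y) * (ker a x y - ker2 a c x y) ∂(sm n) ≤ 0 :=
    integral_nonpos fun y => pol_sign ha c hc u x hx hwx y _ (Or.inr rfl)
  linarith

lemma pol_ae_eq (hn : 2 ≤ n) {a : ℝ} (ha : 0 < a) (c : Eu n) (hc : 1 < ‖c‖) {u : Sph n → ℝ} (hu : Pb u)
    (hJ : J a u 0 ≤ J a (pol a c hc u) 0) : pol a c hc u =ᵐ[sm n] u := by
  have h0 : ‖(0 : Eu n)‖ ≤ 1 := by simp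
  have hP := (pol_pb hn ha c hc hu).bd
  have hw0 : cw c 0 ≤ 1 := by
    rw [cw_le_one_iff c 0 hc h0]; simp
  have h := J_diff hn ha c hc hP hu.bd (pol_sum a c hc u) 0 h0
  have hs : ∀ y : Sph n, (pol a c hc u y - u y) * (ker a (0 : Eu n) (y : Eu n) - ker2 a c 0 (y : Eu n)) ≤ 0 :=
    by
    intro y
    exact pol_sign ha c hc u 0 h0 hw0 y _ (Or.inl rfl)
  have hi : ∫ y, (pol a c hc u y - u y) * (ker a (0 : Eu n) (y : Eu n) - ker2 a c 0 (y : Eu n)) ∂(sm n) ≤ 0 := integral_nonpos hs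
  set G : Sph n → ℝ := fun y => -((pol a c hc u y - u y) * (ker a (0 : Eu n) (y : Eu n) - ker2 a c 0 (y : Eu n))) with hG
  have hz : ∫ y, G y ∂(sm n) = 0 := by
    rw [hG, integral_neg]; linarith
  have hGint : Integrable G (sm n) :=
    ((hP.sub hu.bd).mul ((ker_bd ha 0).sub (ker2_bd ha c hc 0 h0))).integrable.neg
  have hnn : 0 ≤ G := fun y => by have := hs y; simp only [Pi.zero_apply, hG]; linarith
  have hz2 := (integral_eq_zero_iff_of_nonneg hnn hGint).1 hz
  filter_upwards [hz2] with y hy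
  by_cases hwy : cw c (y : Eu n) = 1
  · simp [pol, hwy, fs_eq_self a c hc u y hwy]
  · have h1 := ker_ne_ker2 ha c hc y hwy
    simp only [Pi.zero_apply, hG, neg_eq_zero, mul_eq_zero] at hy
    have := hy.resolve_right h1
    linarith

lemma J_continuous {a : ℝ} (ha : 0 < a) {u : Sph n → ℝ} (hu : Bd u) : Continuous (J a u) := by
  rw [continuous_iff_continuousAt]
  intro x0
  obtain ⟨hm, C, hC⟩ := hu
  unfold J
  refine continuousAt_of_dominated (bound := fun _ => |C| * ((‖x0‖ + 1 + 1) ^ 2) ^ a) ?_ ?_ ?_ ?_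
  · exact Eventually.of_forall fun x =>
      (hm.mul (ker_bd (n := n) ha x).1).aestronglyMeasurable
  · have : ∀ᶠ x in 𝓝 x0, ‖x‖ < ‖x0‖ + 1 :=
      continuous_norm.continuousAt.eventually_lt continuousAt_const (by simp)
    filter_upwards [this] with x hx
    refine ae_of_all _ fun y => ?_
    rw [norm_mul, Real.norm_eq_abs, Real.norm_eq_abs, abs_of_nonneg (ker_nonneg a x (y : Eu n))]
    refine mul_le_mul ((hC y).trans (le_abs_self _)) ?_ (ker_nonneg a x (y : Eu n)) (abs_nonneg _)
    unfold ker
    refine Real.rpow_le_rpow (by positivity) ?_ ha.le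
    refine pow_le_pow_left₀ (norm_nonneg _) ?_ 2
    have h1 := norm_sub_le x (y : Eu n)
    have h2 := nsph y
    linarith
  · exact integrable_const _
  · refine ae_of_all _ fun y => ?_
    have h1 : Continuous fun x : Eu n => ((x, (y : Eu n)) : Eu n × Eu n) :=
      continuous_id.prodMk continuous_const
    exact (continuous_const.mul ((ker_continuous (n := n) ha).comp h1)).continuousAt

lemma exists_sph_ne (hn : 2 ≤ n) (x : Eu n) : ∃ y : Sph n, (y : Eu n) ≠ x := by
  have hpos : 0 < n := by omega
  let e : Eu n := EuclideanSpace.single ⟨0, hpos⟩ 1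
  have he : ‖e‖ = 1 := by simp [e]
  by_cases h : e = x
  · refine ⟨⟨-e, by simp [he]⟩, fun h2 => ?_⟩
    simp only at h2
    have : e = 0 := by
      have h3 : e = -e := h.trans h2.symm
      have h4 : e + e = 0 := by
        nth_rewrite 1 [h3]
        simp
      have h5 : (2 : ℝ) • e = 0 := by rw [two_smul, h4]
      simpa using h5
    rw [this] at he; simp at he
  · exact ⟨⟨e, by simp [he]⟩, h⟩

lemma ker_cont_right {a : ℝ} (ha : 0 < a) (x : Eu n) :
    Continuous fun y : Sph n => ker a x (y : Eu n) := by
  have h1 : Continuous fun y : Sph n => ((x, (y : Eu n)) : Eu n × Eu n) :=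
    continuous_const.prodMk continuous_subtype_val
  have h2 := (ker_continuous (n := n) ha).comp h1
  exact h2

lemma J_one_pos (hn : 2 ≤ n) {a : ℝ} (ha : 0 < a) (x : Eu n) : 0 < J a (fun _ : Sph n => 1) x := by
  obtain ⟨y0, hy0⟩ := exists_sph_ne hn x
  have h2 := ker_cont_right ha x
  have h3 : 0 ≤ (fun y : Sph n => ker a x (y : Eu n)) := by
    intro y
    exact ker_nonneg a x (y : Eu n)
  have h4 : (fun y : Sph n => ker a x (y : Eu n)) y0 ≠ 0 := by
    have : 0 < ‖x - (y0 : Eu n)‖ := norm_pos_iff.2 (sub_ne_zero.2 hy0.symm)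
    simp only [ker]
    positivity
  have h5 := h2.integral_pos_of_hasCompactSupport_nonneg_nonzero (μ := sm n)
    (HasCompactSupport.of_compactSpace _) h3 h4
  unfold J
  simp only [one_mul]
  exact h5

lemma one_bd : Bd (fun _ : Sph n => (1 : ℝ)) := Bd.of_continuous continuous_const

lemma one_pb : Pb (fun _ : Sph n => (1 : ℝ)) := ⟨one_bd, 1, one_pos, fun _ => le_rfl⟩

lemma J_one_lb (hn : 2 ≤ n) {a : ℝ} (ha : 0 < a) :
    ∃ δ > 0, ∀ x : Eu n, ‖x‖ ≤ 1 → δ ≤ J a (fun _ : Sph n => 1) x := by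
  obtain ⟨x0, h0, h⟩ := (isCompact_closedBall (0 : Eu n) 1).exists_isMinOn ⟨0, by simp⟩
    (J_continuous ha (one_bd (n := n))).continuousOn
  exact ⟨_, J_one_pos hn ha x0, fun x hx => h (by simpa using hx)⟩

lemma J_mono {a : ℝ} (ha : 0 < a) {u v : Sph n → ℝ} (hu : Bd u) (hv : Bd v) (h : ∀ y, u y ≤ v y)
    (x : Eu n) : J a u x ≤ J a v x := by
  unfold J
  refine integral_mono (hu.mul (ker_bd ha x)).integrable (hv.mul (ker_bd ha x)).integrable fun y => ?_
  exact mul_le_mul_of_nonneg_right (h y) (ker_nonneg a x (y : Eu n))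

lemma J_const (a : ℝ) (C : ℝ) (x : Eu n) :
    J a (fun _ : Sph n => C) x = C * J a (fun _ : Sph n => 1) x := by
  unfold J
  rw [← integral_const_mul]; simp

lemma J_lb {a : ℝ} (ha : 0 < a) {u : Sph n → ℝ} (hu : Bd u) {ε : ℝ} (h : ∀ y, ε ≤ u y) (x : Eu n) :
    ε * J a (fun _ : Sph n => 1) x ≤ J a u x := by
  rw [← J_const]
  exact J_mono ha (Bd.of_continuous continuous_const) hu h x

lemma Pb.J_lb (hn : 2 ≤ n) {a : ℝ} (ha : 0 < a) {u : Sph n → ℝ} (hu : Pb u) :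
    ∃ δ > 0, ∀ x : Eu n, ‖x‖ ≤ 1 → δ ≤ J a u x := by
  obtain ⟨δ, hδ, h⟩ := J_one_lb hn ha
  obtain ⟨hb, ε, hε, h2⟩ := hu
  exact ⟨ε * δ, by positivity, fun x hx =>
    (mul_le_mul_of_nonneg_left (h x hx) hε.le).trans (HLS.J_lb ha hb h2 x)⟩

lemma Pb.J_pos (hn : 2 ≤ n) {a : ℝ} (ha : 0 < a) {u : Sph n → ℝ} (hu : Pb u) (x : Eu n) (hx : ‖x‖ ≤ 1) :
    0 < J a u x := by
  obtain ⟨δ, hδ, h⟩ := hu.J_lb hn ha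
  exact hδ.trans_le (h x hx)

lemma fin_ball : IsFiniteMeasure ((volume : Measure (Eu n)).restrict (ball 0 1)) :=
  ⟨by simpa using measure_ball_lt_top⟩

/-- the functional -/
def Phi (a q : ℝ) (u : Sph n → ℝ) : ℝ := ∫ x in ball (0 : Eu n) 1, J a u x ^ (-q)

lemma Pb.Phi_int (hn : 2 ≤ n) {a q : ℝ} (ha : 0 < a) (hq : 0 < q) {u : Sph n → ℝ} (hu : Pb u) :
    IntegrableOn (fun x : Eu n => J a u x ^ (-q)) (ball 0 1) := by
  obtain ⟨δ, hδ, h⟩ := hu.J_lb hn ha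
  haveI := fin_ball (n := n)
  refine Integrable.of_bound (C := δ ^ (-q)) ((J_continuous ha hu.bd).measurable.pow_const _).aestronglyMeasurable ?_
  refine (ae_restrict_iff' measurableSet_ball).2 (ae_of_all _ fun x hx => ?_)
  have hx' : ‖x‖ ≤ 1 := by simp at hx; exact hx.le
  have := hδ.trans_le (h x hx')
  rw [Real.norm_eq_abs, abs_of_pos (by positivity)]
  exact Real.rpow_le_rpow_of_nonpos hδ (h x hx') (by linarith)

lemma Phi_fs (hn : 2 ≤ n) {a q : ℝ} (ha : 0 < a) (haq : a * q = n) (c : Eu n) (hc : 1 < ‖c‖)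
    {u : Sph n → ℝ} (hu : Pb u) : Phi a q (fs a c hc u) = Phi a q u := by
  unfold Phi
  rw [← ball_cv c hc fun x => J a u x ^ (-q)]
  refine setIntegral_congr_fun measurableSet_ball fun x hx => ?_
  have hx' : ‖x‖ ≤ 1 := by simp at hx; exact hx.le
  have hw := cw_pos c x hc hx'
  have hJ := (hu.fs a c hc).J_pos hn ha x hx'
  rw [J_fs hn ha c hc hu.bd x hx', Real.mul_rpow (by positivity) hJ.le, ← Real.rpow_mul hw.le,
    mul_neg, haq, Real.rpow_neg hw.le, Real.rpow_natCast]
  field_simp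

lemma rpow_neg_convex {q : ℝ} (hq : 0 < q) : ConvexOn ℝ (Ioi (0 : ℝ)) fun s => s ^ (-q) := by
  refine ⟨convex_Ioi 0, fun x hx y hy s t hs ht hst => ?_⟩
  have hx : 0 < x := hx
  have hy : 0 < y := hy
  have hz : 0 < s • x + t • y := (convex_Ioi (0 : ℝ)) hx hy hs ht hst
  have h1 := strictConcaveOn_log_Ioi.concaveOn.2 hx hy hs ht hst
  have h2 := convexOn_exp.2 (mem_univ (Real.log x * -q)) (mem_univ (Real.log y * -q)) hs ht hst
  simp only [Real.rpow_def_of_pos hx, Real.rpow_def_of_pos hy, Real.rpow_def_of_pos hz]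
  refine le_trans (Real.exp_le_exp.2 ?_) h2
  simp only [smul_eq_mul] at h1 ⊢
  nlinarith

lemma four_point {q : ℝ} (hq : 0 < q) {A A' B B' : ℝ} (hA : 0 < A) (h1 : A ≤ B) (h2 : A ≤ B')
    (hs : A + A' = B + B') : B ^ (-q) + B' ^ (-q) ≤ A ^ (-q) + A' ^ (-q) := by
  have hc := (rpow_neg_convex hq).2
  rcases eq_or_lt_of_le (show A ≤ A' by linarith) with h | h
  · have e1 : B = A := by linarith
    have e2 : B' = A := by linarith
    rw [e1, e2, ← h]
  · set s := (A' - B) / (A' - A) with hs'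
    have hd : 0 < A' - A := by linarith
    have hs0 : 0 ≤ s := div_nonneg (by linarith) hd.le
    have hs1 : s ≤ 1 := (div_le_one hd).2 (by linarith)
    have e : s * (A' - A) = A' - B := div_mul_cancel₀ _ hd.ne'
    have k1 := hc (mem_Ioi.2 hA) (mem_Ioi.2 (hA.trans h)) hs0 (sub_nonneg.2 hs1) (by ring)
    have k2 := hc (mem_Ioi.2 hA) (mem_Ioi.2 (hA.trans h)) (sub_nonneg.2 hs1) hs0 (by ring)
    simp only [smul_eq_mul] at k1 k2
    have e1 : s * A + (1 - s) * A' = B := by linarith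
    have e2 : (1 - s) * A + s * A' = B' := by linarith
    rw [e1] at k1
    rw [e2] at k2
    linarith

lemma Phi_pol (hn : 2 ≤ n) {a q : ℝ} (ha : 0 < a) (hq : 0 < q) (haq : a * q = n) (c : Eu n) (hc : 1 < ‖c‖)
    {u : Sph n → ℝ} (hu : Pb u) : Phi a q u ≤ Phi a q (pol a c hc u) := by
  have hP := pol_pb hn ha c hc hu
  have hPs := hP.fs a c hc
  have hus := hu.fs a c hc
  have key : ∀ x ∈ ball (0 : Eu n) 1, J a u x ^ (-q) + J a (fs a c hc u) x ^ (-q) ≤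
      J a (pol a c hc u) x ^ (-q) + J a (fs a c hc (pol a c hc u)) x ^ (-q) := by
    intro x hx
    have hx' : ‖x‖ ≤ 1 := by simp at hx; exact hx.le
    have hw := cw_pos c x hc hx'
    have hsum : J a (pol a c hc u) x + J a (fs a c hc (pol a c hc u)) x =
        J a u x + J a (fs a c hc u) x := by
      rw [← J_add ha hP.bd hPs.bd, ← J_add ha hu.bd hus.bd]
      simp only [pol_sum]
    rcases le_total (cw c x) 1 with h | h
    · exact four_point hq (hP.J_pos hn ha x hx') (J_pol_le hn ha c hc hu x hx' h)
        (J_pol_le' hn ha c hc hu x hx' h) hsum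
    · have hz := cinv_norm_le c x hc hx'
      have hwz : cw c (cinv c x) ≤ 1 := by
        rw [cw_cinv c x hc hx']; exact inv_le_one_of_one_le₀ h
      have k1 := J_pol_le hn ha c hc hu (cinv c x) hz hwz
      have k2 := J_pol_le' hn ha c hc hu (cinv c x) hz hwz
      rw [J_fs hn ha c hc hP.bd x hx', J_fs hn ha c hc hu.bd x hx'] at k1
      rw [J_fs hn ha c hc hP.bd x hx', J_fs hn ha c hc hus.bd x hx', fs_fs] at k2
      have hwa : 0 < cw c x ^ a := by positivity
      have k1' := le_of_mul_le_mul_left k1 hwa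
      have k2' := le_of_mul_le_mul_left k2 hwa
      have := four_point hq (hPs.J_pos hn ha x hx') k2' k1' (A' := J a (pol a c hc u) x) (by linarith)
      linarith
  have i1 := hu.Phi_int hn ha hq
  have i2 := hus.Phi_int hn ha hq
  have i3 := hP.Phi_int hn ha hq
  have i4 := hPs.Phi_int hn ha hq
  have := setIntegral_mono_on (i1.add i2) (i3.add i4) measurableSet_ball key
  simp only [Pi.add_apply] at this
  rw [integral_add i1 i2, integral_add i3 i4] at this
  have f1 := Phi_fs hn ha haq c hc hu
  have f2 := Phi_fs hn ha haq c hc hP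
  unfold Phi at f1 f2 ⊢
  linarith

lemma Pb.pow_bd {u : Sph n → ℝ} (hu : Pb u) {p : ℝ} (hp : 0 < p) : Bd (fun y => u y ^ p) := by
  have hpos := hu.pos
  obtain ⟨⟨hm, C, hC⟩, _⟩ := hu
  refine ⟨hm.pow_const _, |C| ^ p, fun y => ?_⟩
  have := hpos y
  rw [abs_of_pos (by positivity)]
  exact Real.rpow_le_rpow this.le ((le_abs_self _).trans ((hC y).trans (le_abs_self _))) hp.le

lemma pint_fs (hn : 2 ≤ n) {a p : ℝ} (hbp : ((n : ℝ) - 1 + a) * p = (n : ℝ) - 1) (c : Eu n)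
    (hc : 1 < ‖c‖) {u : Sph n → ℝ} (hu : Pb u) :
    ∫ y, fs a c hc u y ^ p ∂(sm n) = ∫ y, u y ^ p ∂(sm n) := by
  rw [← sphere_cv_integral hn c hc (fun y => u y ^ p) (hu.bd.1.pow_const _)]
  refine integral_congr_ae (ae_of_all _ fun y => ?_)
  have hw := cw_pos c y hc (nsph y).le
  simp only [fs]
  rw [Real.mul_rpow (hu.pos _).le (by positivity), ← Real.rpow_mul hw.le, hbp, ← Real.rpow_natCast,
    Nat.cast_sub (by omega)]
  simp

lemma pint_pol (hn : 2 ≤ n) {a p : ℝ} (ha : 0 < a) (hp : 0 < p)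
    (hbp : ((n : ℝ) - 1 + a) * p = (n : ℝ) - 1) (c : Eu n)
    (hc : 1 < ‖c‖) {u : Sph n → ℝ} (hu : Pb u) :
    ∫ y, pol a c hc u y ^ p ∂(sm n) = ∫ y, u y ^ p ∂(sm n) := by
  have hP := pol_pb hn ha c hc hu
  have hPs := hP.fs a c hc
  have hus := hu.fs a c hc
  have e1 := pint_fs hn hbp c hc hu
  have e2 := pint_fs hn hbp c hc hP
  have e3 : ∫ y, (pol a c hc u y ^ p + fs a c hc (pol a c hc u) y ^ p) ∂(sm n) =
      ∫ y, (u y ^ p + fs a c hc u y ^ p) ∂(sm n) := by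
    refine integral_congr_ae (ae_of_all _ fun y => ?_)
    simp only
    rcases pol_pair a c hc u y with ⟨h, h'⟩ | ⟨h, h'⟩ <;> rw [h, h']
    ring
  rw [integral_add (hP.pow_bd hp).integrable (hPs.pow_bd hp).integrable,
    integral_add (hu.pow_bd hp).integrable (hus.pow_bd hp).integrable] at e3
  linarith

lemma Bd.memLp {u : Sph n → ℝ} (h : Bd u) : MemLp u 2 (sm n) := by
  obtain ⟨hm, C, hC⟩ := h
  exact MemLp.of_bound hm.aestronglyMeasurable C (ae_of_all _ hC)

lemma inner_toLp {v : Sph n → ℝ} (hv : Bd v) (F : Lp ℝ 2 (sm n)) :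
    inner ℝ F (hv.memLp.toLp v) = ∫ y, F y * v y ∂(sm n) := by
  rw [MeasureTheory.L2.inner_def]
  refine integral_congr_ae ?_
  filter_upwards [hv.memLp.coeFn_toLp] with y hy
  rw [hy]; simp [mul_comm]

lemma weak_compact {ε N : ℝ} (hε : 0 < ε) (g : ℕ → Sph n → ℝ) (hm : ∀ k, Measurable (g k))
    (hb : ∀ k y, ε ≤ g k y ∧ g k y ≤ N) :
    ∃ φ : ℕ → ℕ, StrictMono φ ∧ ∃ f : Sph n → ℝ, Measurable f ∧ (∀ᵐ y ∂(sm n), ε ≤ f y ∧ f y ≤ N) ∧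
      ∀ v, Bd v → Tendsto (fun k => ∫ y, g (φ k) y * v y ∂(sm n)) atTop (𝓝 (∫ y, f y * v y ∂(sm n))) := by
  haveI : Fact ((1 : ℝ≥0∞) ≤ 2) := ⟨by norm_num⟩
  haveI : Fact ((2 : ℝ≥0∞) ≠ ⊤) := ⟨by norm_num⟩
  haveI : SecondCountableTopology (Sph n) := inferInstance
  haveI : MeasurableSpace.CountablyGenerated (Sph n) := inferInstance
  haveI : IsSeparable (sm n) := inferInstance
  haveI : SecondCountableTopology (Lp ℝ 2 (sm n)) := inferInstance
  haveI : TopologicalSpace.SeparableSpace (Lp ℝ 2 (sm n)) := inferInstance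
  have hB : ∀ k, Bd (g k) := fun k => (Pb.of_bounds (hm k) hε (hb k)).bd
  let G : ℕ → Lp ℝ 2 (sm n) := fun k => (hB k).memLp.toLp (g k)
  obtain ⟨M, hM⟩ : ∃ M : ℝ, ∀ k, ‖G k‖ ≤ M := by
    refine ⟨_, fun k => Lp.norm_le_of_ae_bound (C := |N|) (abs_nonneg _) ?_⟩
    filter_upwards [(hB k).memLp.coeFn_toLp] with y hy
    rw [hy, Real.norm_eq_abs, abs_of_pos (hε.trans_le (hb k y).1)]
    exact (hb k y).2.trans (le_abs_self _)
  let D : ℕ → WeakDual ℝ (Lp ℝ 2 (sm n)) := fun k =>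
    StrongDual.toWeakDual (InnerProductSpace.toDual ℝ (Lp ℝ 2 (sm n)) (G k))
  have hsc := WeakDual.isSeqCompact_closedBall ℝ (E := Lp ℝ 2 (sm n)) 0 M
  obtain ⟨ψ, _, φ, hφ, hlim⟩ := hsc (x := D) (fun k => by
    simp only [D, mem_preimage, StrongDual.toStrongDual_toWeakDual, mem_closedBall, dist_zero_right,
      LinearIsometryEquiv.norm_map]
    exact hM k)
  let F : Lp ℝ 2 (sm n) := (InnerProductSpace.toDual ℝ (Lp ℝ 2 (sm n))).symm (WeakDual.toStrongDual ψ)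
  have hFint : Integrable F (sm n) := (Lp.memLp F).integrable (by norm_num)
  have hconv : ∀ v, Bd v → Tendsto (fun k => ∫ y, g (φ k) y * v y ∂(sm n)) atTop
      (𝓝 (∫ y, F y * v y ∂(sm n))) := by
    intro v hv
    have h1 := ((WeakDual.eval_continuous (𝕜 := ℝ) (hv.memLp.toLp v)).tendsto ψ).comp hlim
    have h2 : ψ (hv.memLp.toLp v) = ∫ y, F y * v y ∂(sm n) := by
      rw [← inner_toLp hv F]
      have := InnerProductSpace.toDual_symm_apply (𝕜 := ℝ) (x := hv.memLp.toLp v) (y := WeakDual.toStrongDual ψ)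
      rw [this]; rfl
    rw [← h2]
    refine h1.congr fun k => ?_
    have h3 : D (φ k) (hv.memLp.toLp v) = inner ℝ (G (φ k)) (hv.memLp.toLp v) := rfl
    simp only [Function.comp]
    rw [h3, inner_toLp hv]
    refine integral_congr_ae ?_
    filter_upwards [(hB (φ k)).memLp.coeFn_toLp] with y hy
    rw [hy]
  have hset : ∀ A, MeasurableSet A → Tendsto (fun k => ∫ y in A, g (φ k) y ∂(sm n)) atTop
      (𝓝 (∫ y in A, F y ∂(sm n))) := by
    intro A hA
    have hv : Bd (A.indicator (1 : Sph n → ℝ)) := by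
      refine ⟨measurable_one.indicator hA, 1, fun y => ?_⟩
      by_cases h : y ∈ A <;> simp [h]
    have e : ∀ u : Sph n → ℝ, ∫ y, u y * A.indicator (1 : Sph n → ℝ) y ∂(sm n) = ∫ y in A, u y ∂(sm n) := by
      intro u
      rw [← integral_indicator hA]
      congr 1
      funext y
      by_cases h : y ∈ A <;> simp [h]
    have := hconv _ hv
    simp only [e] at this
    exact this
  have hlow : (fun _ => ε) ≤ᵐ[sm n] F := by
    refine ae_le_of_forall_setIntegral_le (integrable_const _) hFint fun A hA _ => ?_
    refine ge_of_tendsto' (hset A hA) fun k => ?_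
    exact integral_mono (integrable_const _) (hB _).integrable.integrableOn fun y => (hb _ y).1
  have hup : F ≤ᵐ[sm n] (fun _ => N) := by
    refine ae_le_of_forall_setIntegral_le hFint (integrable_const _) fun A hA _ => ?_
    refine le_of_tendsto' (hset A hA) fun k => ?_
    exact integral_mono (hB _).integrable.integrableOn (integrable_const _) fun y => (hb _ y).2
  refine ⟨φ, hφ, F, (Lp.stronglyMeasurable F).measurable, ?_, hconv⟩
  filter_upwards [hlow, hup] with y h1 h2 using ⟨h1, h2⟩

lemma weak_compact' {ε N : ℝ} (hε : 0 < ε) (g : ℕ → Sph n → ℝ) (hm : ∀ k, Measurable (g k))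
    (hb : ∀ k y, ε ≤ g k y ∧ g k y ≤ N) (hεN : ε ≤ N) :
    ∃ φ : ℕ → ℕ, StrictMono φ ∧ ∃ f : Sph n → ℝ, Measurable f ∧ (∀ y, ε ≤ f y ∧ f y ≤ N) ∧
      ∀ v, Bd v → Tendsto (fun k => ∫ y, g (φ k) y * v y ∂(sm n)) atTop (𝓝 (∫ y, f y * v y ∂(sm n))) := by
  obtain ⟨φ, hφ, f, hf, hfb, h⟩ := weak_compact hε g hm hb
  refine ⟨φ, hφ, fun y => max ε (min N (f y)), measurable_const.max (measurable_const.min hf),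
    fun y => ⟨le_max_left _ _, max_le hεN (min_le_left _ _)⟩, fun v hv => ?_⟩
  have e : ∫ y, max ε (min N (f y)) * v y ∂(sm n) = ∫ y, f y * v y ∂(sm n) := by
    refine integral_congr_ae ?_
    filter_upwards [hfb] with y hy
    rw [min_eq_right hy.2, max_eq_right hy.1]
  rw [e]
  exact h v hv

/-- the admissible class -/
structure Adm (a p q ε N c0 P0 : ℝ) (u : Sph n → ℝ) : Prop where
  meas : Measurable u
  bnd : ∀ y, ε ≤ u y ∧ u y ≤ N
  pint : c0 ≤ ∫ y, u y ^ p ∂(sm n)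
  phi : P0 ≤ Phi a q u

lemma young {p s t : ℝ} (hp : 0 < p) (hp1 : p < 1) (hs : 0 < s) (ht : 0 < t) :
    s ^ p ≤ s * (p * t ^ (p - 1)) + (1 - p) * t ^ p := by
  have h := Real.geom_mean_le_arith_mean2_weighted hp.le (sub_nonneg.2 hp1.le) hs.le ht.le (by ring)
  have h2 := mul_le_mul_of_nonneg_right h (Real.rpow_nonneg ht.le (p - 1))
  rw [mul_assoc, ← Real.rpow_add ht] at h2
  have e : t ^ p = t * t ^ (p - 1) := by
    rw [← Real.rpow_one_add' ht.le (by simp; exact hp.ne')]; simp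
  rw [e]
  simp at h2
  linarith

lemma exists_min (hn : 2 ≤ n) {a p q ε N c0 P0 : ℝ} (ha : 0 < a) (hp : 0 < p) (hp1 : p < 1) (hq : 0 < q)
    (hε : 0 < ε) {u0 : Sph n → ℝ} (h0 : Adm a p q ε N c0 P0 u0) :
    ∃ f : Sph n → ℝ, Adm a p q ε N c0 P0 f ∧ ∀ u : Sph n → ℝ, Adm a p q ε N c0 P0 u →
      J a f 0 ≤ J a u 0 := by
  set S : Set ℝ := {m | ∃ u : Sph n → ℝ, Adm a p q ε N c0 P0 u ∧ J a u 0 = m} with hS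
  have hpb : ∀ u : Sph n → ℝ, Adm a p q ε N c0 P0 u → Pb u := fun u hu => Pb.of_bounds hu.meas hε hu.bnd
  have hz : ‖(0 : Eu n)‖ ≤ 1 := by simp
  have hbdd : BddBelow S := by
    refine ⟨0, ?_⟩
    rintro m ⟨u, hu, rfl⟩
    exact ((hpb u hu).J_pos hn ha 0 hz).le
  obtain ⟨m, -, hm, hmS⟩ := exists_seq_tendsto_sInf (S := S) ⟨_, u0, h0, rfl⟩ hbdd
  choose g hg hgm using hmS
  obtain ⟨y0, -⟩ := exists_sph_ne hn (0 : Eu n)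
  have hεN : ε ≤ N := (h0.bnd y0).1.trans (h0.bnd y0).2
  obtain ⟨φ, hφ, f, hf, hfb, hlim⟩ := weak_compact' hε g (fun k => (hg k).meas) (fun k => (hg k).bnd) hεN
  have hfp : Pb f := Pb.of_bounds hf hε hfb
  have hJ : ∀ x, Tendsto (fun k => J a (g (φ k)) x) atTop (𝓝 (J a f x)) :=
    fun x => hlim _ (ker_bd ha x)
  refine ⟨f, ⟨hf, hfb, ?_, ?_⟩, ?_⟩
  · have hv : Bd (fun y => p * f y ^ (p - 1)) := by
      refine ⟨(hf.pow_const _).const_mul _, p * ε ^ (p - 1), fun y => ?_⟩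
      have := hε.trans_le (hfb y).1
      rw [abs_of_pos (by positivity)]
      exact mul_le_mul_of_nonneg_left
        (Real.rpow_le_rpow_of_nonpos hε (hfb y).1 (by linarith)) hp.le
    have h1 := hlim _ hv
    have hfpow := (hfp.pow_bd hp)
    have h2 : ∫ y, f y * (p * f y ^ (p - 1)) ∂(sm n) = p * ∫ y, f y ^ p ∂(sm n) := by
      rw [← integral_const_mul]
      refine integral_congr_ae (ae_of_all _ fun y => ?_)
      have ht := hε.trans_le (hfb y).1
      have e : f y ^ p = f y * f y ^ (p - 1) := by
        rw [← Real.rpow_one_add' ht.le (by simp; exact hp.ne')]; simp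
      simp only [e]; ring
    rw [h2] at h1
    have h3 : ∀ k, c0 - (1 - p) * ∫ y, f y ^ p ∂(sm n) ≤ ∫ y, g (φ k) y * (p * f y ^ (p - 1)) ∂(sm n) := by
      intro k
      have hgk := hpb _ (hg (φ k))
      have i1 := (hgk.bd.mul hv).integrable
      have i2 := hfpow.integrable.const_mul (1 - p)
      have := integral_mono (hgk.pow_bd hp).integrable (i1.add i2) fun y =>
        young hp hp1 (hgk.pos y) (hfp.pos y)
      simp only [Pi.add_apply] at this
      rw [integral_add i1 i2, integral_const_mul] at this
      have := (hg (φ k)).pint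
      linarith
    have := ge_of_tendsto' h1 h3
    linarith
  · obtain ⟨δ, hδ, hδ2⟩ := J_one_lb hn ha
    haveI := fin_ball (n := n)
    have hlb : ∀ k x, ‖x‖ ≤ 1 → ε * δ ≤ J a (g (φ k)) x := by
      intro k x hx
      exact (mul_le_mul_of_nonneg_left (hδ2 x hx) hε.le).trans
        (J_lb ha (hpb _ (hg (φ k))).bd (fun y => ((hg (φ k)).bnd y).1) x)
    have hT : Tendsto (fun k => Phi a q (g (φ k))) atTop (𝓝 (Phi a q f)) := by
      unfold Phi
      refine tendsto_integral_of_dominated_convergence (fun _ => (ε * δ) ^ (-q)) ?_ ?_ ?_ ?_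
      · exact fun k => ((J_continuous ha (hpb _ (hg (φ k))).bd).measurable.pow_const _).aestronglyMeasurable
      · exact integrable_const _
      · intro k
        refine (ae_restrict_iff' measurableSet_ball).2 (ae_of_all _ fun x hx => ?_)
        have hx' : ‖x‖ ≤ 1 := by simp at hx; exact hx.le
        have h1 := hlb k x hx'
        have h2 : 0 < ε * δ := by positivity
        have h3 := h2.trans_le h1
        rw [Real.norm_eq_abs, abs_of_pos (by positivity)]
        exact Real.rpow_le_rpow_of_nonpos h2 h1 (by linarith)
      · refine (ae_restrict_iff' measurableSet_ball).2 (ae_of_all _ fun x hx => ?_)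
        have hx' : ‖x‖ ≤ 1 := by simp at hx; exact hx.le
        exact (hJ x).rpow_const (Or.inl (hfp.J_pos hn ha x hx').ne')
    exact ge_of_tendsto' hT fun k => (hg (φ k)).phi
  · intro u hu
    have h1 : Tendsto (fun k => m (φ k)) atTop (𝓝 (sInf S)) := hm.comp hφ.tendsto_atTop
    have h2 := hJ 0
    simp only [hgm] at h2
    rw [tendsto_nhds_unique h2 h1]
    exact csInf_le hbdd ⟨u, hu, rfl⟩

lemma Adm.pol {a p q ε N c0 P0 : ℝ} (hn : 2 ≤ n) (ha : 0 < a) (hp : 0 < p) (hq : 0 < q)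
    (hbp : ((n : ℝ) - 1 + a) * p = (n : ℝ) - 1) (haq : a * q = n)
    (hε : 0 < ε) {u : Sph n → ℝ} (h : Adm a p q ε N c0 P0 u) (c : Eu n) (hc : 1 < ‖c‖) :
    Adm a p q ε N c0 P0 (pol a c hc u) := by
  have hu := Pb.of_bounds h.meas hε h.bnd
  exact ⟨pol_measurable a c hc hu.bd, pol_bounds hn ha c hc hε h.bnd,
    by rw [pint_pol hn ha hp hbp c hc hu]; exact h.pint,
    h.phi.trans (Phi_pol hn ha hq haq c hc hu)⟩

lemma J_congr {a : ℝ} {u v : Sph n → ℝ} (h : u =ᵐ[sm n] v) (x : Eu n) : J a u x = J a v x := by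
  unfold J
  refine integral_congr_ae ?_
  filter_upwards [h] with y hy
  rw [hy]

lemma J_tilde_mono (hn : 2 ≤ n) {a : ℝ} (ha : 0 < a) {u : Sph n → ℝ} (hu : Pb u)
    (h : ∀ (c : Eu n) (hc : 1 < ‖c‖), pol a c hc u =ᵐ[sm n] u) (x z : Eu n) (hxz : ‖x‖ < ‖z‖)
    (hz : ‖z‖ < 1) : J a u x * (1 - ‖z‖ ^ 2) ^ a ≤ J a u z * (1 - ‖x‖ ^ 2) ^ a := by
  obtain ⟨c, hc, e, hw⟩ := exists_swap x z hxz hz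
  have hx : ‖x‖ ≤ 1 := (hxz.trans hz).le
  have hwp := cw_pos c x hc hx
  have h1 := J_pol_le' hn ha c hc hu x hx hw.le
  rw [J_congr (h c hc)] at h1
  have h2 := J_fs hn ha c hc hu.bd x hx
  have h3 := one_sub_cinv c x hc hx
  rw [e] at h2 h3
  have h4 : 0 < 1 - ‖x‖ ^ 2 := by
    have := norm_nonneg x
    nlinarith [hxz.trans hz]
  rw [h3, h2, Real.mul_rpow hwp.le h4.le]
  have : 0 < cw c x ^ a * (1 - ‖x‖ ^ 2) ^ a := by positivity
  nlinarith

lemma J_radial_le (hn : 2 ≤ n) {a : ℝ} (ha : 0 < a) {u : Sph n → ℝ} (hu : Pb u)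
    (h : ∀ (c : Eu n) (hc : 1 < ‖c‖), pol a c hc u =ᵐ[sm n] u) (x z : Eu n) (hxz : ‖x‖ = ‖z‖)
    (hz : ‖z‖ < 1) : J a u x ≤ J a u z := by
  rcases eq_or_lt_of_le (norm_nonneg z) with h0 | h0
  · have e1 : z = 0 := norm_eq_zero.1 h0.symm
    have e2 : x = 0 := norm_eq_zero.1 (hxz.trans h0.symm)
    rw [e1, e2]
  have hc := J_continuous ha hu.bd
  have h4 : 0 < 1 - ‖z‖ ^ 2 := by nlinarith
  have hF : Continuous fun s : ℝ => J a u (s • x) * (1 - ‖z‖ ^ 2) ^ a :=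
    (hc.comp (by fun_prop : Continuous fun s : ℝ => s • x)).mul continuous_const
  have hG : Continuous fun s : ℝ => J a u z * (1 - ‖s • x‖ ^ 2) ^ a :=
    continuous_const.mul ((by fun_prop : Continuous fun s : ℝ => 1 - ‖s • x‖ ^ 2).rpow_const
      fun _ => Or.inr ha.le)
  have hle : ∀ᶠ s in 𝓝[<] (1 : ℝ), J a u (s • x) * (1 - ‖z‖ ^ 2) ^ a ≤ J a u z * (1 - ‖s • x‖ ^ 2) ^ a := by
    filter_upwards [Ioo_mem_nhdsLT (zero_lt_one' ℝ)] with s hs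
    refine J_tilde_mono hn ha hu h _ _ ?_ hz
    rw [norm_smul, Real.norm_eq_abs, abs_of_pos hs.1, hxz]
    nlinarith [hs.2]
  have := le_of_tendsto_of_tendsto ((hF.tendsto 1).mono_left nhdsWithin_le_nhds)
    ((hG.tendsto 1).mono_left nhdsWithin_le_nhds) hle
  rw [one_smul, hxz] at this
  exact le_of_mul_le_mul_right this (by positivity)

lemma J_radial (hn : 2 ≤ n) {a : ℝ} (ha : 0 < a) {u : Sph n → ℝ} (hu : Pb u)
    (h : ∀ (c : Eu n) (hc : 1 < ‖c‖), pol a c hc u =ᵐ[sm n] u) (x z : Eu n) (hxz : ‖x‖ = ‖z‖)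
    (hz : ‖z‖ < 1) : J a u x = J a u z :=
  le_antisymm (J_radial_le hn ha hu h x z hxz hz) (J_radial_le hn ha hu h z x hxz.symm (hxz ▸ hz))

lemma pol_one (hn : 2 ≤ n) {a : ℝ} (ha : 0 < a) (c : Eu n) (hc : 1 < ‖c‖) :
    pol a c hc (fun _ : Sph n => 1) =ᵐ[sm n] fun _ => 1 := by
  refine ae_of_all _ fun y => ?_
  have hb := pol_bounds hn ha c hc (u := fun _ : Sph n => 1) one_pos (fun _ => ⟨le_rfl, le_rfl⟩) y
  exact le_antisymm hb.2 hb.1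

lemma ker_swap (a r : ℝ) (y w : Sph n) : ker a (r • (w : Eu n)) (y : Eu n) = ker a (r • (y : Eu n)) (w : Eu n) := by
  unfold ker
  congr 1
  rw [norm_sub_sq_real, norm_sub_sq_real, norm_smul, norm_smul, nsph, nsph, inner_smul_left, inner_smul_left,
    real_inner_comm]

lemma J_average (hn : 2 ≤ n) {a : ℝ} (ha : 0 < a) {u : Sph n → ℝ} (hu : Pb u)
    (h : ∀ (c : Eu n) (hc : 1 < ‖c‖), pol a c hc u =ᵐ[sm n] u) (x : Eu n) (hx : ‖x‖ < 1) :
    (sm n).real univ * J a u x = (∫ y, u y ∂(sm n)) * J a (fun _ : Sph n => 1) x := by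
  have hr : ∀ w : Sph n, ‖‖x‖ • (w : Eu n)‖ = ‖x‖ := by
    intro w
    rw [norm_smul, nsph]; simp
  have e1 : ∫ w : Sph n, J a u (‖x‖ • (w : Eu n)) ∂(sm n) = (sm n).real univ * J a u x := by
    have : ∀ w : Sph n, J a u (‖x‖ • (w : Eu n)) = J a u x := fun w =>
      J_radial hn ha hu h _ _ (hr w) hx
    simp only [this, integral_const, smul_eq_mul]
  have e2 : ∫ w : Sph n, J a u (‖x‖ • (w : Eu n)) ∂(sm n) =
      ∫ y : Sph n, ∫ w : Sph n, u y * ker a (‖x‖ • (w : Eu n)) (y : Eu n) ∂(sm n) ∂(sm n) := by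
    unfold J
    refine integral_integral_swap (f := fun w y : Sph n => u y * ker a (‖x‖ • (w : Eu n)) (y : Eu n)) ?_
    obtain ⟨⟨hm, C, hC⟩, _⟩ := hu
    have hcont : Continuous fun z : Sph n × Sph n => ker a (‖x‖ • (z.1 : Eu n)) (z.2 : Eu n) := by
      have h1 : Continuous fun z : Sph n × Sph n => ((‖x‖ • (z.1 : Eu n), (z.2 : Eu n)) : Eu n × Eu n) := by
        fun_prop
      have h2 := (ker_continuous (n := n) ha).comp h1
      exact h2
    obtain ⟨D, hD⟩ := isCompact_univ.exists_bound_of_continuousOn (hcont.continuousOn (s := univ))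
    refine Integrable.of_bound (C := C * D)
      ((hm.comp measurable_snd).mul hcont.measurable).aestronglyMeasurable (ae_of_all _ fun z => ?_)
    simp only [Function.uncurry]
    rw [norm_mul]
    exact mul_le_mul (hC _) (hD z (mem_univ _)) (norm_nonneg _) ((abs_nonneg _).trans (hC z.2))
  have e3 : ∀ y : Sph n, ∫ w : Sph n, u y * ker a (‖x‖ • (w : Eu n)) (y : Eu n) ∂(sm n) =
      u y * J a (fun _ : Sph n => 1) x := by
    intro y
    rw [integral_const_mul]
    congr 1
    have : J a (fun _ : Sph n => 1) x = J a (fun _ : Sph n => 1) (‖x‖ • (y : Eu n)) :=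
      J_radial hn ha one_pb (pol_one hn ha) _ _ (hr y).symm (by rw [hr y]; exact hx)
    rw [this]
    unfold J
    refine integral_congr_ae (ae_of_all _ fun w => ?_)
    simp only [one_mul]
    exact ker_swap a ‖x‖ y w
  rw [← e1, e2]
  simp only [e3]
  rw [integral_mul_const]

lemma sm_pos (hn : 2 ≤ n) : 0 < (sm n).real univ := by
  haveI : Nonempty (Sph n) := ⟨(exists_sph_ne hn 0).choose⟩
  exact measureReal_univ_pos (μ := sm n)

theorem bounded_ineq (hn : 2 ≤ n) {a p q : ℝ} (ha : 0 < a) (hp : 0 < p) (hp1 : p < 1) (hq : 0 < q)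
    (hbp : ((n : ℝ) - 1 + a) * p = (n : ℝ) - 1) (haq : a * q = n) {u : Sph n → ℝ} (hu : Pb u) :
    Phi a q u ≤ ((∫ y, u y ^ p ∂(sm n)) / (sm n).real univ) ^ (-(q / p)) * Phi a q (fun _ : Sph n => 1) := by
  have hS := sm_pos (n := n) hn
  obtain ⟨⟨hm, N, hN⟩, ε, hε, hlow⟩ := id hu
  have h0 : Adm a p q ε N (∫ y, u y ^ p ∂(sm n)) (Phi a q u) u :=
    ⟨hm, fun y => ⟨hlow y, (le_abs_self _).trans (hN y)⟩, le_rfl, le_rfl⟩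
  obtain ⟨f, hf, hmin⟩ := exists_min hn ha hp hp1 hq hε h0
  have hfp : Pb f := Pb.of_bounds hf.meas hε hf.bnd
  have hpol : ∀ (c : Eu n) (hc : 1 < ‖c‖), pol a c hc f =ᵐ[sm n] f := fun c hc =>
    pol_ae_eq hn ha c hc hfp (hmin _ (hf.pol hn ha hp hq hbp haq hε c hc))
  set m := (∫ y, f y ∂(sm n)) / (sm n).real univ with hmdef
  have hmS : m * (sm n).real univ = ∫ y, f y ∂(sm n) := div_mul_cancel₀ _ hS.ne'
  have hJ : ∀ x : Eu n, ‖x‖ < 1 → J a f x = m * J a (fun _ : Sph n => 1) x := by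
    intro x hx
    have := J_average hn ha hfp hpol x hx
    rw [hmdef]; field_simp; linarith
  have hmpos : 0 < m := by
    have h1 := hJ 0 (by simp)
    have h2 := hfp.J_pos hn ha 0 (by simp)
    have h3 := J_one_pos hn ha (0 : Eu n)
    rw [h1] at h2
    exact (pos_iff_pos_of_mul_pos h2).2 h3
  have hPhi : Phi a q f = m ^ (-q) * Phi a q (fun _ : Sph n => 1) := by
    unfold Phi
    rw [← integral_const_mul]
    refine setIntegral_congr_fun measurableSet_ball fun x hx => ?_
    have hx' : ‖x‖ < 1 := by simpa using hx
    rw [hJ x hx', Real.mul_rpow hmpos.le (J_one_pos hn ha x).le]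
  have hpi : 0 < ∫ y, u y ^ p ∂(sm n) := by
    have h1 : ∫ _, ε ^ p ∂(sm n) ≤ ∫ y, u y ^ p ∂(sm n) :=
      integral_mono (integrable_const _) (hu.pow_bd hp).integrable fun y =>
        Real.rpow_le_rpow hε.le (hlow y) hp.le
    rw [integral_const, smul_eq_mul] at h1
    have : 0 < (sm n).real univ * ε ^ p := by positivity
    linarith
  have hjensen : ∫ y, f y ^ p ∂(sm n) ≤ m ^ p * (sm n).real univ := by
    have i1 := hfp.bd.integrable.mul_const (p * m ^ (p - 1))
    have i2 : Integrable (fun _ : Sph n => (1 - p) * m ^ p) (sm n) := integrable_const _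
    have := integral_mono (hfp.pow_bd hp).integrable (i1.add i2) fun y =>
      young hp hp1 (hfp.pos y) hmpos
    simp only [Pi.add_apply] at this
    rw [integral_add i1 i2, integral_mul_const, integral_const, smul_eq_mul, ← hmS] at this
    have e : m ^ p = m * m ^ (p - 1) := by
      rw [← Real.rpow_one_add' hmpos.le (by simp; exact hp.ne')]; simp
    rw [e] at this ⊢
    linarith
  have h5 : (∫ y, u y ^ p ∂(sm n)) / (sm n).real univ ≤ m ^ p := by
    rw [div_le_iff₀ hS]
    exact hf.pint.trans hjensen
  have h6 : m ^ (-q) ≤ ((∫ y, u y ^ p ∂(sm n)) / (sm n).real univ) ^ (-(q / p)) := by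
    have e : m ^ (-q) = (m ^ p) ^ (-(q / p)) := by
      rw [← Real.rpow_mul hmpos.le]
      congr 1; field_simp
    rw [e]
    exact Real.rpow_le_rpow_of_nonpos (by positivity) h5 (by
      have : 0 < q / p := by positivity
      linarith)
  have h7 : 0 ≤ Phi a q (fun _ : Sph n => 1) := by
    unfold Phi
    refine setIntegral_nonneg measurableSet_ball fun x _ => ?_
    have := J_one_pos hn ha x
    positivity
  refine hf.phi.trans ?_
  rw [hPhi]
  exact mul_le_mul_of_nonneg_right h6 h7

lemma lint_J {a : ℝ} (ha : 0 < a) {u : Sph n → ℝ} (hu : Bd u) (h0 : ∀ y, 0 ≤ u y) (x : Eu n) :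
    ∫⁻ y : Sph n, ENNReal.ofReal (u y) * ENNReal.ofReal (ker a x (y : Eu n)) ∂(sm n) =
      ENNReal.ofReal (J a u x) := by
  unfold J
  rw [ofReal_integral_eq_lintegral_ofReal (hu.mul (ker_bd ha x)).integrable
    (ae_of_all _ fun y => mul_nonneg (h0 y) (ker_nonneg a x (y : Eu n)))]
  refine lintegral_congr fun y => ?_
  rw [ENNReal.ofReal_mul (h0 y)]

/-- the right hand side -/
def RHS (a : ℝ) (u : Sph n → ℝ) (G : Eu n → ℝ) : ℝ≥0∞ :=
  ∫⁻ x in ball (0 : Eu n) 1, ∫⁻ y : Sph n, ENNReal.ofReal (G x) * ENNReal.ofReal (u y) *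
    ENNReal.ofReal (ker a x (y : Eu n)) ∂(sm n)

lemma RHS_eq {a : ℝ} (ha : 0 < a) {u : Sph n → ℝ} (hu : Bd u) (h0 : ∀ y, 0 ≤ u y) (G : Eu n → ℝ) :
    RHS a u G = ∫⁻ x in ball (0 : Eu n) 1, ENNReal.ofReal (G x) * ENNReal.ofReal (J a u x) := by
  unfold RHS
  refine lintegral_congr fun x => ?_
  rw [← lint_J ha hu h0 x, ← lintegral_const_mul' _ _ ENNReal.ofReal_ne_top]
  refine lintegral_congr fun y => ?_
  rw [mul_assoc]

/-- the sharp constant -/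
def Cst (n : ℕ) (a p q : ℝ) : ℝ :=
  (sm n).real univ ^ (-(1 / p)) * Phi a q (fun _ : Sph n => 1) ^ (-(1 / q))

lemma Phi_pos (hn : 2 ≤ n) {a q : ℝ} (ha : 0 < a) (hq : 0 < q) {u : Sph n → ℝ} (hu : Pb u) :
    0 < Phi a q u := by
  have hp : ∀ x ∈ ball (0 : Eu n) 1, 0 < J a u x ^ (-q) := by
    intro x hx
    have hx' : ‖x‖ ≤ 1 := by simp at hx; exact hx.le
    have := hu.J_pos hn ha x hx'
    positivity
  unfold Phi
  rw [setIntegral_pos_iff_support_of_nonneg_ae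
    ((ae_restrict_iff' measurableSet_ball).2 (ae_of_all _ fun x hx => (hp x hx).le)) (hu.Phi_int hn ha hq)]
  have : Function.support (fun x : Eu n => J a u x ^ (-q)) ∩ ball 0 1 = ball 0 1 :=
    inter_eq_right.2 fun x hx => (hp x hx).ne'
  rw [this]
  exact measure_ball_pos _ _ one_pos

lemma lint_Phi (hn : 2 ≤ n) {a q : ℝ} (ha : 0 < a) (hq : 0 < q) {u : Sph n → ℝ} (hu : Pb u) :
    ∫⁻ x in ball (0 : Eu n) 1, ENNReal.ofReal (J a u x ^ (-q)) = ENNReal.ofReal (Phi a q u) := by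
  unfold Phi
  rw [ofReal_integral_eq_lintegral_ofReal (hu.Phi_int hn ha hq)]
  refine (ae_restrict_iff' measurableSet_ball).2 (ae_of_all _ fun x hx => ?_)
  have hx' : ‖x‖ ≤ 1 := by simp at hx; exact hx.le
  have := hu.J_pos hn ha x hx'
  simp only [Pi.zero_apply]
  positivity

lemma rev_holder (hn : 2 ≤ n) {a q t : ℝ} (ha : 0 < a) (hq : 0 < q) (ht : 0 < t) (ht1 : t < 1)
    (htq : t = q * (1 - t)) {u : Sph n → ℝ} (hu : Pb u) (G : Eu n → ℝ) (hG : Measurable G) :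
    (∫⁻ x in ball (0 : Eu n) 1, ENNReal.ofReal (G x) ^ t) ^ (1 / t) ≤
      RHS a u G * ENNReal.ofReal (Phi a q u ^ (1 / q)) := by
  have h1t : 0 < 1 - t := by linarith
  have hJm : Measurable (J a u) := (J_continuous ha hu.bd).measurable
  have hconj : (1 / t).HolderConjugate (1 / (1 - t)) := by
    rw [Real.holderConjugate_iff]
    refine ⟨by rw [lt_div_iff₀ ht]; linarith, by simp⟩
  have h := ENNReal.lintegral_mul_le_Lp_mul_Lq ((volume : Measure (Eu n)).restrict (ball 0 1)) hconj
    (f := fun x => (ENNReal.ofReal (G x) * ENNReal.ofReal (J a u x)) ^ t)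
    (g := fun x => ENNReal.ofReal (J a u x ^ (-t))) (by fun_prop)
    ((hJm.pow_const _).ennreal_ofReal.aemeasurable)
  have e1 : ∫⁻ x in ball (0 : Eu n) 1, ENNReal.ofReal (G x) ^ t = ∫⁻ x in ball (0 : Eu n) 1,
      ((fun x => (ENNReal.ofReal (G x) * ENNReal.ofReal (J a u x)) ^ t) *
        (fun x => ENNReal.ofReal (J a u x ^ (-t)))) x := by
    refine setLIntegral_congr_fun measurableSet_ball fun x hx => ?_
    have hx' : ‖x‖ ≤ 1 := by simp at hx; exact hx.le
    have hJ := hu.J_pos hn ha x hx'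
    simp only [Pi.mul_apply]
    rw [ENNReal.mul_rpow_of_nonneg _ _ ht.le, ENNReal.ofReal_rpow_of_pos hJ, mul_assoc,
      ← ENNReal.ofReal_mul (by positivity), ← Real.rpow_add hJ]
    simp
  have e2 : ∫⁻ x in ball (0 : Eu n) 1, ((ENNReal.ofReal (G x) * ENNReal.ofReal (J a u x)) ^ t) ^ (1 / t)
      = RHS a u G := by
    rw [RHS_eq ha hu.bd (fun y => (hu.pos y).le)]
    refine lintegral_congr fun x => ?_
    rw [← ENNReal.rpow_mul, mul_one_div_cancel ht.ne', ENNReal.rpow_one]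
  have e3 : ∫⁻ x in ball (0 : Eu n) 1, (ENNReal.ofReal (J a u x ^ (-t))) ^ (1 / (1 - t))
      = ENNReal.ofReal (Phi a q u) := by
    rw [← lint_Phi hn ha hq hu]
    refine setLIntegral_congr_fun measurableSet_ball fun x hx => ?_
    have hx' : ‖x‖ ≤ 1 := by simp at hx; exact hx.le
    have hJ := hu.J_pos hn ha x hx'
    rw [ENNReal.ofReal_rpow_of_pos (by positivity), ← Real.rpow_mul hJ.le]
    congr 2
    field_simp
    linarith
  rw [← e1, e2, e3] at h
  have hP := Phi_pos hn ha hq hu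
  calc _ ≤ (RHS a u G ^ (1 / (1 / t)) * ENNReal.ofReal (Phi a q u) ^ (1 / (1 / (1 - t)))) ^ (1 / t) :=
        ENNReal.rpow_le_rpow h (by positivity)
    _ = _ := by
        rw [ENNReal.mul_rpow_of_nonneg _ _ (by positivity), ← ENNReal.rpow_mul, ← ENNReal.rpow_mul,
          ENNReal.ofReal_rpow_of_pos hP]
        have e4 : 1 / (1 / t) * (1 / t) = 1 := by field_simp
        have e5 : 1 / (1 / (1 - t)) * (1 / t) = 1 / q := by
          rw [one_div_one_div]
          field_simp
          linarith
        rw [e4, e5, ENNReal.rpow_one]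

lemma core_pb (hn : 2 ≤ n) {a p q t : ℝ} (ha : 0 < a) (hp : 0 < p) (hp1 : p < 1) (hq : 0 < q)
    (hbp : ((n : ℝ) - 1 + a) * p = (n : ℝ) - 1) (haq : a * q = n) (ht : 0 < t) (ht1 : t < 1)
    (htq : t = q * (1 - t)) {u : Sph n → ℝ} (hu : Pb u) (G : Eu n → ℝ) (hG : Measurable G) :
    ENNReal.ofReal (Cst n a p q) * (∫⁻ y, ENNReal.ofReal (u y) ^ p ∂(sm n)) ^ (1 / p) *
      (∫⁻ x in ball (0 : Eu n) 1, ENNReal.ofReal (G x) ^ t) ^ (1 / t) ≤ RHS a u G := by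
  have hS := sm_pos (n := n) hn
  have hP := Phi_pos hn ha hq hu
  have hP1 := Phi_pos hn ha hq (one_pb (n := n))
  have hb := bounded_ineq hn ha hp hp1 hq hbp haq hu
  set A := ∫ y, u y ^ p ∂(sm n) with hA
  have e1 : ∫⁻ y, ENNReal.ofReal (u y) ^ p ∂(sm n) = ENNReal.ofReal A := by
    rw [hA, ofReal_integral_eq_lintegral_ofReal (hu.pow_bd hp).integrable
      (ae_of_all _ fun y => Real.rpow_nonneg (hu.pos y).le _)]
    refine lintegral_congr fun y => ?_
    rw [ENNReal.ofReal_rpow_of_pos (hu.pos y)]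
  have hA0 : 0 ≤ A := integral_nonneg fun y => Real.rpow_nonneg (hu.pos y).le _
  rcases eq_or_lt_of_le hA0 with h0 | hApos
  · rw [e1, ← h0]
    have : 0 < 1 / p := by positivity
    simp [ENNReal.zero_rpow_of_pos this, hp]
  have hC0 : 0 ≤ Cst n a p q := by unfold Cst; positivity
  have key : Cst n a p q * A ^ (1 / p) * Phi a q u ^ (1 / q) ≤ 1 := by
    have h1 : Phi a q u ^ (1 / q) ≤ (A / (sm n).real univ) ^ (-(1 / p)) *
        Phi a q (fun _ : Sph n => 1) ^ (1 / q) := by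
      refine (Real.rpow_le_rpow hP.le hb (by positivity)).trans_eq ?_
      rw [Real.mul_rpow (by positivity) hP1.le, ← Real.rpow_mul (by positivity)]
      congr 2
      field_simp
    refine (mul_le_mul_of_nonneg_left h1 (by positivity)).trans_eq ?_
    unfold Cst
    rw [Real.rpow_neg hS.le (1 / p), Real.rpow_neg hP1.le (1 / q),
      Real.rpow_neg (div_pos hApos hS).le (1 / p), Real.div_rpow hApos.le hS.le]
    have h2 : 0 < A ^ (1 / p) := by positivity
    have h3 : 0 < (sm n).real univ ^ (1 / p) := by positivity
    have h4 : 0 < Phi a q (fun _ : Sph n => 1) ^ (1 / q) := by positivity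
    generalize A ^ (1 / p) = X at *
    generalize (sm n).real univ ^ (1 / p) = Y at *
    generalize Phi a q (fun _ : Sph n => 1) ^ (1 / q) = Z at *
    field_simp
  rw [e1, ENNReal.ofReal_rpow_of_pos hApos, ← ENNReal.ofReal_mul hC0]
  calc _ ≤ ENNReal.ofReal (Cst n a p q * A ^ (1 / p)) * (RHS a u G * ENNReal.ofReal (Phi a q u ^ (1 / q))) :=
        mul_le_mul_right (rev_holder hn ha hq ht ht1 htq hu G hG) _
    _ = ENNReal.ofReal (Cst n a p q * A ^ (1 / p) * Phi a q u ^ (1 / q)) * RHS a u G := by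
        rw [ENNReal.ofReal_mul (p := Cst n a p q * A ^ (1 / p)) (by positivity)]; ring
    _ ≤ 1 * RHS a u G := by
        refine mul_le_mul_left ?_ _
        exact ENNReal.ofReal_le_one.2 key
    _ = _ := one_mul _

lemma RHS_mono {a : ℝ} {u v : Sph n → ℝ} {G H : Eu n → ℝ} (h1 : ∀ y, u y ≤ v y) (h2 : ∀ x, G x ≤ H x) :
    RHS a u G ≤ RHS a v H := by
  unfold RHS
  refine lintegral_mono fun x => lintegral_mono fun y => ?_
  exact mul_le_mul' (mul_le_mul' (ENNReal.ofReal_le_ofReal (h2 x)) (ENNReal.ofReal_le_ofReal (h1 y))) le_rfl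

lemma RHS_one_fin {a : ℝ} (ha : 0 < a) {G : Eu n → ℝ} {N : ℝ} (hN : ∀ x, G x ≤ N) :
    RHS a (fun _ : Sph n => 1) G ≠ ⊤ := by
  rw [RHS_eq ha one_bd (fun _ => zero_le_one)]
  obtain ⟨C, hC⟩ := (isCompact_closedBall (0 : Eu n) 1).exists_bound_of_continuousOn
    (J_continuous ha (one_bd (n := n))).continuousOn
  refine ne_of_lt (lt_of_le_of_lt (setLIntegral_mono (g := fun _ => ENNReal.ofReal N * ENNReal.ofReal C)
    measurable_const fun x hx => ?_) ?_)
  · have := hC x (ball_subset_closedBall hx)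
    exact mul_le_mul' (ENNReal.ofReal_le_ofReal (hN x)) (ENNReal.ofReal_le_ofReal ((le_abs_self _).trans this))
  · rw [setLIntegral_const]
    exact ENNReal.mul_lt_top (ENNReal.mul_lt_top ENNReal.ofReal_lt_top ENNReal.ofReal_lt_top) measure_ball_lt_top

lemma RHS_add {a : ℝ} (ha : 0 < a) {u : Sph n → ℝ} (hu : Bd u) (h0 : ∀ y, 0 ≤ u y) {G : Eu n → ℝ}
    (hG : Measurable G) {e : ℝ} (he : 0 < e) :
    RHS a (fun y => u y + e) G = RHS a u G + ENNReal.ofReal e * RHS a (fun _ : Sph n => 1) G := by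
  have hb : Bd (fun _ : Sph n => e) := Bd.of_continuous continuous_const
  rw [RHS_eq ha (hu.add hb) (fun y => add_nonneg (h0 y) he.le), RHS_eq ha hu h0,
    RHS_eq ha one_bd (fun _ => zero_le_one), ← lintegral_const_mul' _ _ ENNReal.ofReal_ne_top,
    ← lintegral_add_left]
  · refine lintegral_congr fun x => ?_
    have hJ0 : 0 ≤ J a u x := integral_nonneg fun y => mul_nonneg (h0 y) (ker_nonneg a x (y : Eu n))
    have hJ1 : 0 ≤ J a (fun _ : Sph n => 1) x :=
      integral_nonneg fun y => mul_nonneg zero_le_one (ker_nonneg a x (y : Eu n))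
    have e2 : J a (fun _ : Sph n => e) x = e * J a (fun _ : Sph n => 1) x := by
      unfold J
      rw [← integral_const_mul]
      simp only [one_mul]
    rw [J_add ha hu hb, e2, ENNReal.ofReal_add hJ0 (by positivity), ENNReal.ofReal_mul he.le]
    ring
  · exact hG.ennreal_ofReal.mul (J_continuous ha hu).measurable.ennreal_ofReal

lemma core_bdd (hn : 2 ≤ n) {a p q t : ℝ} (ha : 0 < a) (hp : 0 < p) (hp1 : p < 1) (hq : 0 < q)
    (hbp : ((n : ℝ) - 1 + a) * p = (n : ℝ) - 1) (haq : a * q = n) (ht : 0 < t) (ht1 : t < 1)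
    (htq : t = q * (1 - t)) {u : Sph n → ℝ} (hu : Bd u) (h0 : ∀ y, 0 ≤ u y) (G : Eu n → ℝ)
    (hG : Measurable G) {N : ℝ} (hN : ∀ x, G x ≤ N) :
    ENNReal.ofReal (Cst n a p q) * (∫⁻ y, ENNReal.ofReal (u y) ^ p ∂(sm n)) ^ (1 / p) *
      (∫⁻ x in ball (0 : Eu n) 1, ENNReal.ofReal (G x) ^ t) ^ (1 / t) ≤ RHS a u G := by
  have hlim : Tendsto (fun k : ℕ => RHS a u G + ENNReal.ofReal (1 / ((k : ℝ) + 1)) *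
      RHS a (fun _ : Sph n => 1) G) atTop (𝓝 (RHS a u G + ENNReal.ofReal 0 *
      RHS a (fun _ : Sph n => 1) G)) := by
    refine tendsto_const_nhds.add (ENNReal.Tendsto.mul_const ?_ (Or.inr (RHS_one_fin ha hN)))
    exact ENNReal.tendsto_ofReal tendsto_one_div_add_atTop_nhds_zero_nat
  rw [ENNReal.ofReal_zero, zero_mul, add_zero] at hlim
  refine ge_of_tendsto' hlim fun k => ?_
  have he : (0 : ℝ) < 1 / ((k : ℝ) + 1) := by positivity
  rw [← RHS_add ha hu h0 hG he]
  have hb : Bd (fun _ : Sph n => 1 / ((k : ℝ) + 1)) := Bd.of_continuous continuous_const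
  have hpb : Pb (fun y => u y + 1 / ((k : ℝ) + 1)) := ⟨hu.add hb, _, he, fun y => by linarith [h0 y]⟩
  refine le_trans ?_ (core_pb hn ha hp hp1 hq hbp haq ht ht1 htq hpb G hG)
  refine mul_le_mul' (mul_le_mul' le_rfl (ENNReal.rpow_le_rpow (lintegral_mono fun y => ?_) (by positivity))) le_rfl
  exact ENNReal.rpow_le_rpow (ENNReal.ofReal_le_ofReal (by linarith)) hp.le

lemma trunc_lim {X : Type*} [MeasurableSpace X] (μ : Measure X) {f : X → ℝ} (hf : Measurable f) {r : ℝ}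
    (hr : 0 < r) : Tendsto (fun k : ℕ => (∫⁻ x, ENNReal.ofReal (min (f x) k) ^ r ∂μ) ^ (1 / r)) atTop
      (𝓝 ((∫⁻ x, ENNReal.ofReal (f x) ^ r ∂μ) ^ (1 / r))) := by
  refine (ENNReal.continuous_rpow_const.tendsto _).comp ?_
  refine lintegral_tendsto_of_tendsto_of_monotone (fun k => ?_) (ae_of_all _ fun x => ?_) (ae_of_all _ fun x => ?_)
  · exact ((hf.min measurable_const).ennreal_ofReal.pow_const r).aemeasurable
  · intro i j hij
    refine ENNReal.rpow_le_rpow (ENNReal.ofReal_le_ofReal (min_le_min le_rfl ?_)) hr.le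
    exact_mod_cast hij
  · refine tendsto_const_nhds.congr' ?_
    obtain ⟨m, hm⟩ := exists_nat_ge (f x)
    filter_upwards [eventually_ge_atTop m] with k hk
    have : (m : ℝ) ≤ k := by exact_mod_cast hk
    rw [min_eq_left (hm.trans this)]

lemma core (hn : 2 ≤ n) {a p q t : ℝ} (ha : 0 < a) (hp : 0 < p) (hp1 : p < 1) (hq : 0 < q)
    (hbp : ((n : ℝ) - 1 + a) * p = (n : ℝ) - 1) (haq : a * q = n) (ht : 0 < t) (ht1 : t < 1)
    (htq : t = q * (1 - t)) {u : Sph n → ℝ} (hu : Measurable u) (h0 : ∀ y, 0 ≤ u y) (G : Eu n → ℝ)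
    (hG : Measurable G) 
    (hf1 : (∫⁻ y, ENNReal.ofReal (u y) ^ p ∂(sm n)) ^ (1 / p) ≠ ⊤)
    (hf2 : (∫⁻ x in ball (0 : Eu n) 1, ENNReal.ofReal (G x) ^ t) ^ (1 / t) ≠ ⊤) :
    ENNReal.ofReal (Cst n a p q) * (∫⁻ y, ENNReal.ofReal (u y) ^ p ∂(sm n)) ^ (1 / p) *
      (∫⁻ x in ball (0 : Eu n) 1, ENNReal.ofReal (G x) ^ t) ^ (1 / t) ≤ RHS a u G := by
  have hl := ENNReal.Tendsto.mul (ENNReal.Tendsto.const_mul (trunc_lim (sm n) hu hp)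
    (Or.inr (ENNReal.ofReal_ne_top (r := Cst n a p q))))
    (Or.inr hf2) (trunc_lim ((volume : Measure (Eu n)).restrict (ball 0 1)) hG ht)
    (Or.inr (ENNReal.mul_ne_top ENNReal.ofReal_ne_top hf1))
  refine le_of_tendsto' hl fun k => ?_
  have hb : Bd (fun y => min (u y) (k : ℝ)) := by
    refine ⟨hu.min measurable_const, k, fun y => ?_⟩
    rw [abs_of_nonneg (le_min (h0 y) (Nat.cast_nonneg k))]
    exact min_le_right _ _
  refine (core_bdd hn ha hp hp1 hq hbp haq ht ht1 htq hb (fun y => le_min (h0 y) (Nat.cast_nonneg k))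
    (fun x => min (G x) (k : ℝ)) (hG.min measurable_const) (fun x => min_le_right _ _)).trans ?_
  exact RHS_mono (fun y => min_le_left _ _) (fun x => min_le_left _ _)

lemma emb_s : MeasurableEmbedding (fun y : Sph n => zo n + (y : Eu n)) := by
  have h := (MeasurableEquiv.addLeft (zo n)).measurableEmbedding.comp
    (MeasurableEmbedding.subtype_coe (isClosed_sphere (x := (0 : Eu n)) (ε := 1)).measurableSet)
  exact h

lemma lint_surf (h : Eu n → ℝ≥0∞) : ∫⁻ y, h y ∂(surf n) = ∫⁻ y : Sph n, h (zo n + (y : Eu n)) ∂(sm n) := by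
  unfold surf
  rw [emb_s.lintegral_map]

lemma int_surf (h : Eu n → ℝ) : ∫ y, h y ∂(surf n) = ∫ y : Sph n, h (zo n + (y : Eu n)) ∂(sm n) := by
  unfold surf
  rw [emb_s.integral_map]

lemma pre_ball : (fun x : Eu n => zo n + x) ⁻¹' (ball (zo n) 1) = ball (0 : Eu n) 1 := by
  ext x
  simp [mem_ball, dist_eq_norm]

lemma mp_tr : MeasurePreserving (fun x : Eu n => zo n + x) volume volume := measurePreserving_add_left _ _

lemma emb_tr : MeasurableEmbedding (fun x : Eu n => zo n + x) :=
  (MeasurableEquiv.addLeft (zo n)).measurableEmbedding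

lemma lint_ballM (h : Eu n → ℝ≥0∞) :
    ∫⁻ x, h x ∂(ballM n) = ∫⁻ x in ball (0 : Eu n) 1, h (zo n + x) := by
  unfold ballM
  rw [← mp_tr.setLIntegral_comp_preimage_emb emb_tr, pre_ball]

lemma int_ballM (h : Eu n → ℝ) :
    ∫ x in ball (zo n) 1, h x = ∫ x in ball (0 : Eu n) 1, h (zo n + x) := by
  rw [← mp_tr.setIntegral_preimage_emb emb_tr, pre_ball]

lemma ker_tr (α : ℝ) (x y : Eu n) :
    ‖zo n + x - (zo n + y)‖ ^ (α - (n : ℝ)) = ker ((α - n) / 2) x y := by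
  unfold ker
  rw [add_sub_add_left_eq_sub, ← Real.rpow_natCast, ← Real.rpow_mul (norm_nonneg _)]
  congr 1
  push_cast
  ring

lemma ker_tr1 (α : ℝ) (x y : Eu n) :
    ‖x - (zo n + y)‖ ^ (α - (n : ℝ)) = ker ((α - n) / 2) (x - zo n) y := by
  rw [← ker_tr]; simp

lemma sm_eq : (sm n).real univ = (n : ℝ) * unitBallVol n := by
  rw [Measure.toSphere_real_apply_univ, finrank_euclideanSpace, Fintype.card_fin]
  rfl

lemma Ce1_eq (hn : 2 ≤ n) {α : ℝ} (hα : (n : ℝ) < α) {p : ℝ} 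
    (hp : p = 2 * ((n : ℝ) - 1) / ((n : ℝ) + α - 2)) :
    Ce1 n α = Cst n ((α - n) / 2) p (2 * n / (α - n)) := by
  have hn' : (2 : ℝ) ≤ n := by exact_mod_cast hn
  have h1 : (n : ℝ) - α ≠ 0 := by linarith
  have h2 : α - (n : ℝ) ≠ 0 := by linarith
  unfold Ce1 Cst Phi J
  rw [int_ballM, sm_eq]
  congr 1
  · congr 1
    rw [hp, one_div_div]
  · have e1 : ((n : ℝ) - α) / (2 * n) = -(1 / (2 * n / (α - n))) := by
      rw [one_div_div, ← neg_div]; congr 1; ring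
    have e2 : 2 * (n : ℝ) / (n - α) = -(2 * n / (α - n)) := by
      rw [← neg_div_neg_eq, neg_sub, neg_div]
    rw [e1, e2]
    congr 1
    refine integral_congr_ae (ae_of_all _ fun x => ?_)
    simp only
    rw [int_surf]
    simp only [ker_tr, one_mul]

lemma RHS_tr (α : ℝ) (f g : Eu n → ℝ) :
    ∫⁻ x, ∫⁻ y, ENNReal.ofReal (g x) * ENNReal.ofReal (f y) *
                ENNReal.ofReal (‖x - y‖ ^ (α - (n : ℝ))) ∂surf n ∂ballM n =
      RHS ((α - n) / 2) (fun y : Sph n => f (zo n + (y : Eu n))) (fun x => g (zo n + x)) := by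
  unfold RHS
  rw [lint_ballM]
  refine lintegral_congr fun x => ?_
  rw [lint_surf]
  simp only [ker_tr]

lemma params (hn : 2 ≤ n) {α : ℝ} (hα : (n : ℝ) < α) {p t a q : ℝ}
    (hp : p = 2 * ((n : ℝ) - 1) / ((n : ℝ) + α - 2))
    (ht : t = 2 * (n : ℝ) / ((n : ℝ) + α)) (hA : a = (α - n) / 2) (hQ : q = 2 * n / (α - n)) :
    0 < a ∧ 0 < p ∧ p < 1 ∧ 0 < q ∧ ((n : ℝ) - 1 + a) * p = (n : ℝ) - 1 ∧ a * q = n ∧ 0 < t ∧ t < 1 ∧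
      t = q * (1 - t) := by
  have hn' : (2 : ℝ) ≤ n := by exact_mod_cast hn
  have h2 : 0 < α - (n : ℝ) := by linarith
  have h3 : 0 < (n : ℝ) + α - 2 := by linarith
  have h4 : 0 < (n : ℝ) + α := by linarith
  have h5 : 0 < (n : ℝ) - 1 := by linarith
  subst hp ht hA hQ
  refine ⟨by positivity, by positivity, ?_, by positivity, ?_, ?_, by positivity, ?_, ?_⟩
  · rw [div_lt_one h3]; linarith
  · field_simp; ring
  · field_simp
  · rw [div_lt_one h4]; linarith
  · field_simp; ring

theorem part1 (hn : 2 ≤ n) {α : ℝ} (hα : (n : ℝ) < α) {p t : ℝ}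
    (hp : p = 2 * ((n : ℝ) - 1) / ((n : ℝ) + α - 2))
    (ht : t = 2 * (n : ℝ) / ((n : ℝ) + α))
    (f : Eu n → ℝ) (h0 : ∀ y, 0 ≤ f y) (hf : Measurable f) (hf1 : eLp (surf n) f p ≠ ⊤)
    (g : Eu n → ℝ) (hg : Measurable g) (hg1 : eLp (ballM n) g t ≠ ⊤) :
        ENNReal.ofReal (Ce1 n α) * eLp (surf n) f p * eLp (ballM n) g t ≤
          ∫⁻ x, ∫⁻ y,
              ENNReal.ofReal (g x) * ENNReal.ofReal (f y) *
                ENNReal.ofReal (‖x - y‖ ^ (α - (n : ℝ)))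
            ∂surf n ∂ballM n := by
  obtain ⟨c1, c2, c3, c4, c5, c6, c7, c8, c9⟩ := params hn hα hp ht rfl rfl
  rw [RHS_tr, Ce1_eq hn hα hp]
  unfold eLp at *
  rw [lint_surf] at *
  rw [lint_ballM] at *
  exact core hn c1 c2 c3 c4 c5 c6 c7 c8 c9 (hf.comp emb_s.measurable) (fun y => h0 _) _
    (hg.comp emb_tr.measurable) hf1 hg1

theorem part2 (hn : 2 ≤ n) {α : ℝ} (hα : (n : ℝ) < α) {p t : ℝ}
    (hp : p = 2 * ((n : ℝ) - 1) / ((n : ℝ) + α - 2))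
    (ht : t = 2 * (n : ℝ) / ((n : ℝ) + α)) (C : ℝ)
    (H : ∀ (f : Eu n → ℝ), (∀ y, 0 ≤ f y) → Measurable f → eLp (surf n) f p ≠ ⊤ →
        ∀ (g : Eu n → ℝ), (∀ x, 0 ≤ g x) → Measurable g → eLp (ballM n) g t ≠ ⊤ →
          ENNReal.ofReal C * eLp (surf n) f p * eLp (ballM n) g t ≤
            ∫⁻ x, ∫⁻ y,
                ENNReal.ofReal (g x) * ENNReal.ofReal (f y) *
                  ENNReal.ofReal (‖x - y‖ ^ (α - (n : ℝ)))
              ∂surf n ∂ballM n) : C ≤ Ce1 n α := by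
  rw [Ce1_eq hn hα hp]
  obtain ⟨c1, c2, c3, c4, c5, c6, c7, c8, c9⟩ := params hn hα hp ht rfl rfl
  simp only [RHS_tr] at H
  generalize (α - n) / 2 = a at *
  generalize 2 * n / (α - n) = q at *
  have hS := sm_pos (n := n) hn
  have hI := Phi_pos hn c1 c4 (one_pb (n := n))
  set S := (sm n).real univ with hSd
  set I := Phi a q (fun _ : Sph n => 1) with hId
  have hJ : Measurable (J a (fun _ : Sph n => 1)) := (J_continuous c1 one_bd).measurable
  have hJp := J_one_pos (n := n) hn c1
  have e1 : eLp (surf n) (fun _ => 1) p = ENNReal.ofReal (S ^ (1 / p)) := by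
    unfold eLp
    rw [lint_surf, ← ENNReal.ofReal_rpow_of_pos hS]
    rw [hSd, Measure.real, ENNReal.ofReal_toReal (measure_ne_top _ _)]
    simp only [ENNReal.ofReal_one, ENNReal.one_rpow, lintegral_const, one_mul]
  have e2 : eLp (ballM n) (fun x => J a (fun _ : Sph n => 1) (x - zo n) ^ (-(q + 1))) t =
      ENNReal.ofReal (I ^ (1 / t)) := by
    unfold eLp
    rw [lint_ballM, ← ENNReal.ofReal_rpow_of_pos hI, hId, ← lint_Phi hn c1 c4 one_pb]
    congr 1
    refine lintegral_congr fun x => ?_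
    simp only
    rw [add_sub_cancel_left, ENNReal.ofReal_rpow_of_pos (Real.rpow_pos_of_pos (hJp x) _),
      ← Real.rpow_mul (hJp x).le]
    congr 2
    linarith
  have e3 : RHS a (fun _ : Sph n => 1) (fun x => J a (fun _ : Sph n => 1) (zo n + x - zo n) ^ (-(q + 1)))
      = ENNReal.ofReal I := by
    rw [RHS_eq c1 one_bd (fun _ => zero_le_one), hId, ← lint_Phi hn c1 c4 one_pb]
    refine lintegral_congr fun x => ?_
    rw [add_sub_cancel_left, ← ENNReal.ofReal_mul (Real.rpow_pos_of_pos (hJp x) _).le]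
    congr 1
    nth_rewrite 2 [← Real.rpow_one (J a (fun _ : Sph n => 1) x)]
    rw [← Real.rpow_add (hJp x)]
    congr 1
    ring
  have h := H (fun _ => 1) (fun _ => zero_le_one) measurable_const (by rw [e1]; exact ENNReal.ofReal_ne_top)
    (fun x => J a (fun _ : Sph n => 1) (x - zo n) ^ (-(q + 1)))
    (fun x => (Real.rpow_pos_of_pos (hJp _) _).le)
    ((hJ.comp (measurable_id.sub_const _)).pow_const _) (by rw [e2]; exact ENNReal.ofReal_ne_top)
  rw [e1, e2, e3] at h
  have hC0 : 0 ≤ Cst n a p q := by unfold Cst; positivity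
  rcases le_or_gt C 0 with hC | hC
  · exact hC.trans hC0
  rw [← ENNReal.ofReal_mul hC.le, ← ENNReal.ofReal_mul (by positivity), ENNReal.ofReal_le_ofReal_iff hI.le] at h
  have e4 : I = I ^ (-(1 / q)) * I ^ (1 / t) := by
    rw [← Real.rpow_add hI]
    have : -(1 / q) + 1 / t = 1 := by
      field_simp
      linarith
    rw [this, Real.rpow_one]
  have h1 : C * S ^ (1 / p) ≤ I ^ (-(1 / q)) := by
    refine le_of_mul_le_mul_right ?_ (Real.rpow_pos_of_pos hI (1 / t))
    rw [← e4]; exact h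
  unfold Cst
  rw [Real.rpow_neg hS.le, ← hId, inv_mul_eq_div, le_div_iff₀ (by positivity)]
  exact h1

end HLS

/-- Theorem 2.1, sharp reversed HLS inequality on the ball,
with sharp constant. -/
theorem reversed_HLS_ball_sharp
    (n : ℕ) (hn : 2 ≤ n) (α : ℝ) (hα : (n : ℝ) < α) (p t : ℝ)
    (hp : p = 2 * ((n : ℝ) - 1) / ((n : ℝ) + α - 2))
    (ht : t = 2 * (n : ℝ) / ((n : ℝ) + α)) :
    (∀ (f : Eu n → ℝ), (∀ y, 0 ≤ f y) → Measurable f → eLp (surf n) f p ≠ ⊤ →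
      ∀ (g : Eu n → ℝ), (∀ x, 0 ≤ g x) → Measurable g → eLp (ballM n) g t ≠ ⊤ →
        ENNReal.ofReal (Ce1 n α) * eLp (surf n) f p * eLp (ballM n) g t ≤
          ∫⁻ x, ∫⁻ y,
              ENNReal.ofReal (g x) * ENNReal.ofReal (f y) *
                ENNReal.ofReal (‖x - y‖ ^ (α - (n : ℝ)))
            ∂surf n ∂ballM n) ∧
    (∀ C : ℝ,
      (∀ (f : Eu n → ℝ), (∀ y, 0 ≤ f y) → Measurable f → eLp (surf n) f p ≠ ⊤ →
        ∀ (g : Eu n → ℝ), (∀ x, 0 ≤ g x) → Measurable g → eLp (ballM n) g t ≠ ⊤ →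
          ENNReal.ofReal C * eLp (surf n) f p * eLp (ballM n) g t ≤
            ∫⁻ x, ∫⁻ y,
                ENNReal.ofReal (g x) * ENNReal.ofReal (f y) *
                  ENNReal.ofReal (‖x - y‖ ^ (α - (n : ℝ)))
              ∂surf n ∂ballM n) → C ≤ Ce1 n α) := by
  exact ⟨fun f h0 hf hf1 g _ hg hg1 => HLS.part1 hn hα hp ht f h0 hf hf1 g hg hg1,
    fun C H => HLS.part2 hn hα hp ht C H⟩
end
end

section
/- Let n ≥ 2, α > n, 0 < p < 2(n-1)/(n+α-2) and 0 < t < 2n/(n+α). Then there is a constant C(n,α,p,t) > 0 such that for all nonnegative f ∈ L^p(∂B^n) and g ∈ L^t(B^n), one has ∫_{B^n} ∫_{∂B^n} g(x) f(y) |x−y|^{α−n} dy dx ≥ C(n,α,p,t) ‖f‖_{L^p(∂B^n)} ‖g‖_{L^t(B^n)}. -/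
noncomputable section

open MeasureTheory Metric ENNReal

/-- Reverse Hoelder inequality. -/
theorem aux_reverse_holder {X : Type*} [MeasurableSpace X] (μ : Measure X) (u w : X → ℝ≥0∞)
    (hu : Measurable u) (hw : Measurable w) (hwt : ∀ x, w x ≠ ⊤) (t : ℝ) (ht0 : 0 < t)
    (ht1 : t < 1) (K : ℝ≥0∞) (hK : K ≠ ⊤) (hKi : ∫⁻ x, w x ^ (-(t / (1 - t))) ∂μ ≤ K) :
    (∫⁻ x, u x ^ t ∂μ) ^ (1 / t) ≤ K ^ ((1 - t) / t) * ∫⁻ x, u x * w x ∂μ := by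
  have h1t : 0 < 1 - t := by linarith
  have hwm : Measurable fun x => w x ^ (-(t / (1 - t))) := hw.pow_const _
  have hne : ∀ᵐ x ∂μ, w x ≠ 0 := by
    filter_upwards [ae_lt_top hwm (ne_top_of_le_ne_top hK hKi)] with x hx h0
    rw [h0, ENNReal.zero_rpow_of_neg (by simp; positivity)] at hx
    exact lt_irrefl _ hx
  have key : ∫⁻ x, u x ^ t ∂μ ≤ (∫⁻ x, u x * w x ∂μ) ^ t * K ^ (1 - t) := by
    calc ∫⁻ x, u x ^ t ∂μ
        = ∫⁻ x, (u x * w x) ^ t * (w x ^ (-(t / (1 - t)))) ^ (1 - t) ∂μ := by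
          apply lintegral_congr_ae
          filter_upwards [hne] with x hx
          rw [← ENNReal.rpow_mul, ENNReal.mul_rpow_of_nonneg _ _ ht0.le, mul_assoc,
            ← ENNReal.rpow_add _ _ hx (hwt x)]
          have : t + -(t / (1 - t)) * (1 - t) = 0 := by field_simp; ring
          rw [this]; simp
      _ ≤ (∫⁻ x, u x * w x ∂μ) ^ t * (∫⁻ x, w x ^ (-(t / (1 - t))) ∂μ) ^ (1 - t) :=
          ENNReal.lintegral_mul_norm_pow_le (hu.mul hw).aemeasurable hwm.aemeasurable
            ht0.le h1t.le (by ring)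
      _ ≤ _ := by gcongr
  calc (∫⁻ x, u x ^ t ∂μ) ^ (1 / t)
      ≤ ((∫⁻ x, u x * w x ∂μ) ^ t * K ^ (1 - t)) ^ (1 / t) := by gcongr
    _ = _ := by
      rw [ENNReal.mul_rpow_of_nonneg _ _ (by positivity), ← ENNReal.rpow_mul, ← ENNReal.rpow_mul,
        mul_one_div_cancel ht0.ne', ENNReal.rpow_one, mul_comm, mul_one_div]

/-- Dyadic pointwise bound of a negative power of the distance. -/
theorem aux_dyadic_pointwise {n : ℕ} (β : ℝ) (hβ : 0 < β) (x₀ x : Eu n) :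
    edist x x₀ ^ (-β) ≤ 1 + ∑' k : ℕ, (ball x₀ ((2⁻¹ : ℝ) ^ k)).indicator
      (fun _ => (2 : ℝ≥0∞) ^ (((k : ℝ) + 1) * β)) x := by
  rcases le_or_gt 1 (dist x x₀) with h1 | h1
  · refine le_add_right ?_
    rw [edist_dist]
    have : (1 : ℝ≥0∞) ≤ ENNReal.ofReal (dist x x₀) := by simpa using h1
    rw [ENNReal.rpow_neg, ENNReal.inv_le_one]
    exact ENNReal.one_le_rpow this hβ
  refine le_add_left ?_
  rcases (dist_nonneg (x := x) (y := x₀)).eq_or_lt with h0 | h0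
  · have hx : x = x₀ := dist_eq_zero.1 h0.symm
    subst hx
    have : ∀ k : ℕ, (1 : ℝ≥0∞) ≤ (ball x ((2⁻¹ : ℝ) ^ k)).indicator
      (fun _ => (2 : ℝ≥0∞) ^ (((k : ℝ) + 1) * β)) x := by
      intro k
      rw [Set.indicator_of_mem (mem_ball_self (by positivity))]
      exact ENNReal.one_le_rpow (by norm_num) (by positivity)
    calc _ ≤ (⊤ : ℝ≥0∞) := le_top
      _ = ∑' k : ℕ, (1 : ℝ≥0∞) := (ENNReal.tsum_const_eq_top_of_ne_zero one_ne_zero).symm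
      _ ≤ _ := ENNReal.tsum_le_tsum this
  · obtain ⟨k, hk1, hk2⟩ : ∃ k : ℕ, (2⁻¹ : ℝ) ^ (k + 1) ≤ dist x x₀ ∧
        dist x x₀ < (2⁻¹ : ℝ) ^ k := by
      obtain ⟨k, hk1, hk2⟩ := exists_nat_pow_near_of_lt_one h0 h1.le
        (show (0 : ℝ) < 2⁻¹ by norm_num) (by norm_num)
      rcases hk2.eq_or_lt with h | h
      · cases k with
        | zero => simp at h; linarith
        | succ k =>
          refine ⟨k, h.ge, ?_⟩
          rw [h, pow_succ]
          have : (0 : ℝ) < 2⁻¹ ^ k := by positivity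
          linarith
      · exact ⟨k, hk1.le, h⟩
    refine le_trans ?_ (ENNReal.le_tsum k)
    rw [Set.indicator_of_mem (mem_ball.2 hk2), edist_dist, ENNReal.ofReal_rpow_of_pos h0]
    have h2 : (2 : ℝ≥0∞) ^ (((k : ℝ) + 1) * β) = ENNReal.ofReal ((2 : ℝ) ^ (((k : ℝ) + 1) * β)) := by
      rw [← ENNReal.ofReal_rpow_of_pos (by norm_num), ENNReal.ofReal_ofNat]
    rw [h2]
    apply ENNReal.ofReal_le_ofReal
    calc dist x x₀ ^ (-β) ≤ ((2⁻¹ : ℝ) ^ (k + 1)) ^ (-β) :=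
          Real.rpow_le_rpow_of_nonpos (by positivity) hk1 (by linarith)
      _ = _ := by
          rw [← Real.rpow_natCast, Real.inv_rpow (by norm_num), ← Real.rpow_neg (by norm_num),
            ← Real.rpow_mul (by norm_num)]
          push_cast
          ring_nf

theorem aux_riesz_bound (d β : ℝ) (hβ : 0 < β) (hd : β < d) (M : ℝ≥0∞) (hM : M ≠ ⊤) :
    ∃ K : ℝ≥0∞, K ≠ ⊤ ∧ ∀ (n : ℕ) (μ : Measure (Eu n)) (x₀ : Eu n), μ Set.univ ≤ M →
      (∀ k : ℕ, μ (ball x₀ ((2⁻¹ : ℝ) ^ k)) ≤ M * (2 : ℝ≥0∞) ^ (-((k : ℝ) * d))) →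
      ∫⁻ x, edist x x₀ ^ (-β) ∂μ ≤ K := by
  refine ⟨M + ∑' k : ℕ, M * 2 ^ β * ((2 : ℝ≥0∞) ^ (β - d)) ^ k, ?_, ?_⟩
  · rw [ENNReal.tsum_mul_left, ENNReal.tsum_geometric]
    refine ENNReal.add_ne_top.2 ⟨hM, ENNReal.mul_ne_top (ENNReal.mul_ne_top hM (by simp)) ?_⟩
    rw [ENNReal.inv_ne_top]
    refine (tsub_pos_of_lt ?_).ne'
    exact ENNReal.rpow_lt_one_of_one_lt_of_neg (by norm_num) (by linarith)
  · intro n μ x₀ hu hb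
    calc ∫⁻ x, edist x x₀ ^ (-β) ∂μ
        ≤ ∫⁻ x, (1 + ∑' k : ℕ, (ball x₀ ((2⁻¹ : ℝ) ^ k)).indicator
            (fun _ => (2 : ℝ≥0∞) ^ (((k : ℝ) + 1) * β)) x) ∂μ :=
          lintegral_mono fun x => aux_dyadic_pointwise β hβ x₀ x
      _ = μ Set.univ + ∑' k : ℕ, (2 : ℝ≥0∞) ^ (((k : ℝ) + 1) * β) *
            μ (ball x₀ ((2⁻¹ : ℝ) ^ k)) := by
          rw [lintegral_add_left measurable_const, lintegral_tsum]
          · simp [lintegral_indicator_const, measurableSet_ball]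
          · intro k
            exact (measurable_const.indicator measurableSet_ball).aemeasurable
      _ ≤ _ := by
          refine add_le_add hu (ENNReal.tsum_le_tsum fun k => ?_)
          calc (2 : ℝ≥0∞) ^ (((k : ℝ) + 1) * β) * μ (ball x₀ ((2⁻¹ : ℝ) ^ k))
              ≤ (2 : ℝ≥0∞) ^ (((k : ℝ) + 1) * β) * (M * (2 : ℝ≥0∞) ^ (-((k : ℝ) * d))) := by
                gcongr; exact hb k
            _ = M * ((2 : ℝ≥0∞) ^ (((k : ℝ) + 1) * β) * (2 : ℝ≥0∞) ^ (-((k : ℝ) * d))) := by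
                ring
            _ = _ := by
                rw [← ENNReal.rpow_add _ _ (by norm_num) (by norm_num), mul_assoc,
                  ← ENNReal.rpow_natCast, ← ENNReal.rpow_mul,
                  ← ENNReal.rpow_add _ _ (by norm_num) (by norm_num)]
                congr 2; ring

theorem aux_ball_vol (n : ℕ) (c : Eu n) (k : ℕ) :
    (volume : Measure (Eu n)) (ball c ((2⁻¹ : ℝ) ^ k)) ≤
      volume (ball (0 : Eu n) 1) * (2 : ℝ≥0∞) ^ (-((k : ℝ) * n)) := by
  rw [Measure.addHaar_ball_of_pos _ _ (by positivity), mul_comm]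
  gcongr
  rw [finrank_euclideanSpace_fin, ENNReal.rpow_neg, ← ENNReal.ofReal_ofNat,
    ENNReal.ofReal_rpow_of_pos (by norm_num), ← ENNReal.ofReal_inv_of_pos (by positivity)]
  apply ENNReal.ofReal_le_ofReal
  rw [← Nat.cast_mul, Real.rpow_natCast, ← pow_mul, inv_pow]

open scoped Pointwise in
theorem aux_cap (n : ℕ) (c : Eu n) (hc : ‖c‖ ≤ 1) (k : ℕ) :
    (volume : Measure (Eu n)).toSphere {p | (p : Eu n) ∈ ball c ((2⁻¹ : ℝ) ^ k)} ≤
      (n * 2 ^ n * volume (ball (0 : Eu n) 1)) * (2 : ℝ≥0∞) ^ (-((k : ℝ) * ((n : ℝ) - 1))) := by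
  have hms : MeasurableSet {p : sphere (0 : Eu n) 1 | (p : Eu n) ∈ ball c ((2⁻¹ : ℝ) ^ k)} :=
    measurable_subtype_coe measurableSet_ball
  rw [Measure.toSphere_apply' _ hms, finrank_euclideanSpace_fin]
  set ρ : ℝ := (2⁻¹ : ℝ) ^ k with hρ
  have hρ0 : 0 < ρ := by positivity
  have hρ1 : (2 : ℝ) ^ k * ρ = 1 := by rw [hρ, ← mul_pow]; norm_num
  have hsub : Set.Ioo (0 : ℝ) 1 • ((↑) '' {p : sphere (0 : Eu n) 1 | (p : Eu n) ∈ ball c ρ} : Set (Eu n)) ⊆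
      ⋃ j ∈ Finset.range (2 ^ k), ball (((j : ℝ) * ρ) • c) (2 * ρ) := by
    rintro z hz
    obtain ⟨s, hs, y, ⟨q, hq, rfl⟩, rfl⟩ := Set.mem_smul.1 hz
    have hq' : ‖(q : Eu n) - c‖ < ρ := by simpa [dist_eq_norm] using hq
    simp only [Set.mem_iUnion, Finset.mem_range]
    refine ⟨⌊s * 2 ^ k⌋₊, ?_, ?_⟩
    · rw [Nat.floor_lt (by have := hs.1; positivity)]
      push_cast
      have : (0 : ℝ) < 2 ^ k := by positivity
      nlinarith [hs.2]
    · set j := ⌊s * 2 ^ k⌋₊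
      have h1 : (j : ℝ) ≤ s * 2 ^ k := Nat.floor_le (by have := hs.1; positivity)
      have h2 : s * 2 ^ k < j + 1 := Nat.lt_floor_add_one _
      have h3 : (j : ℝ) * ρ ≤ s := by
        calc (j : ℝ) * ρ ≤ s * 2 ^ k * ρ := by gcongr
          _ = s := by rw [mul_assoc, hρ1, mul_one]
      have h4 : s ≤ (j : ℝ) * ρ + ρ := by
        calc s = s * 2 ^ k * ρ := by rw [mul_assoc, hρ1, mul_one]
          _ ≤ (j + 1) * ρ := by gcongr
          _ = _ := by ring
      rw [mem_ball, dist_eq_norm]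
      have e : s • (q : Eu n) - ((j : ℝ) * ρ) • c = s • ((q : Eu n) - c) + (s - j * ρ) • c := by
        module
      rw [e]
      have h5 : ‖s • ((q : Eu n) - c)‖ < ρ := by
        rw [norm_smul, Real.norm_of_nonneg hs.1.le]
        nlinarith [hs.1, hs.2, norm_nonneg ((q : Eu n) - c)]
      have h6 : ‖(s - j * ρ) • c‖ ≤ ρ := by
        rw [norm_smul, Real.norm_of_nonneg (by linarith)]
        nlinarith [norm_nonneg c]
      linarith [norm_add_le (s • ((q : Eu n) - c)) ((s - j * ρ) • c)]
  have hvol : ∀ c' : Eu n, (volume : Measure (Eu n)) (ball c' (2 * ρ)) ≤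
      2 ^ n * (volume (ball (0 : Eu n) 1) * (2 : ℝ≥0∞) ^ (-((k : ℝ) * n))) := by
    intro c'
    rw [Measure.addHaar_ball_mul_of_pos _ _ (by norm_num), finrank_euclideanSpace_fin,
      ENNReal.ofReal_pow (by norm_num), ENNReal.ofReal_ofNat]
    gcongr
    exact aux_ball_vol n 0 k
  calc (n : ℝ≥0∞) * volume _ ≤ n * ∑ j ∈ Finset.range (2 ^ k),
        (volume : Measure (Eu n)) (ball (((j : ℝ) * ρ) • c) (2 * ρ)) := by
        gcongr
        exact (measure_mono hsub).trans (measure_biUnion_finset_le _ _)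
    _ ≤ n * ∑ j ∈ Finset.range (2 ^ k),
        (2 ^ n * (volume (ball (0 : Eu n) 1) * (2 : ℝ≥0∞) ^ (-((k : ℝ) * n)))) := by
        gcongr with j hj
        exact hvol _
    _ = n * 2 ^ n * volume (ball (0 : Eu n) 1) *
          ((2 : ℝ≥0∞) ^ (k : ℝ) * (2 : ℝ≥0∞) ^ (-((k : ℝ) * n))) := by
        rw [Finset.sum_const, Finset.card_range, nsmul_eq_mul, ENNReal.rpow_natCast]
        push_cast
        ring
    _ = _ := by
        rw [← ENNReal.rpow_add _ _ (by norm_num) (by norm_num)]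
        congr 2; ring

theorem aux_surf_ball (n : ℕ) (c : Eu n) (hc : ‖c - zo n‖ ≤ 1) (k : ℕ) :
    surf n (ball c ((2⁻¹ : ℝ) ^ k)) ≤
      (n * 2 ^ n * volume (ball (0 : Eu n) 1)) * (2 : ℝ≥0∞) ^ (-((k : ℝ) * ((n : ℝ) - 1))) := by
  rw [surf, Measure.map_apply (by fun_prop) measurableSet_ball]
  refine le_trans (measure_mono ?_) (aux_cap n (c - zo n) hc k)
  intro q hq
  simp only [Set.mem_preimage, mem_ball, dist_eq_norm, Set.mem_ofPred_eq] at hq ⊢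
  convert hq using 2
  abel

theorem aux_surf_univ (n : ℕ) :
    surf n Set.univ ≤ (n * 2 ^ n * volume (ball (0 : Eu n) 1)) := by
  rw [surf, Measure.map_apply (by fun_prop) MeasurableSet.univ, Set.preimage_univ,
    Measure.toSphere_apply_univ, finrank_euclideanSpace_fin]
  gcongr
  exact le_mul_of_one_le_right (by positivity) (one_le_pow₀ (by norm_num))

theorem aux_kernel {X : Type*} [PseudoEMetricSpace X] (m : ℝ) (hm : 0 < m) (x x₀ y : X) :
    edist x x₀ ^ m * edist y x₀ ^ m ≤ 2 ^ m * (edist x y ^ (2 * m) + edist x₀ y ^ (2 * m)) := by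
  set a := edist x y
  have hb : edist y x₀ = edist x₀ y := edist_comm _ _
  rw [hb]
  set b := edist x₀ y
  have h1 : edist x x₀ ≤ 2 * max a b := by
    calc edist x x₀ ≤ a + edist y x₀ := edist_triangle _ _ _
      _ ≤ max a b + max a b := by rw [hb]; exact add_le_add (le_max_left _ _) (le_max_right _ _)
      _ = _ := (two_mul _).symm
  calc edist x x₀ ^ m * b ^ m ≤ (2 * max a b) ^ m * (max a b) ^ m := by
        gcongr
        exact le_max_right _ _
    _ = 2 ^ m * (max a b) ^ (2 * m) := by
        rw [ENNReal.mul_rpow_of_nonneg _ _ hm.le, mul_assoc,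
          ← ENNReal.rpow_add_of_nonneg _ _ hm.le hm.le, two_mul]
    _ ≤ _ := by
        gcongr
        rcases max_choice a b with h | h <;> rw [h]
        · exact le_self_add
        · exact le_add_self

theorem aux_min (n : ℕ) (F : Eu n → ℝ≥0∞) (hF : Measurable F) (hFt : ∀ y, F y ≠ ⊤) (l : ℝ) (hl : 0 < l)
    (σ : Measure (Eu n)) :
    ∃ x₀ ∈ closedBall (zo n) 1, ∀ x ∈ closedBall (zo n) 1,
      ∫⁻ y, F y * edist x₀ y ^ l ∂σ ≤ ∫⁻ y, F y * edist x y ^ l ∂σ := by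
  have hlsc : LowerSemicontinuous fun x : Eu n => ∫⁻ y, F y * edist x y ^ l ∂σ := by
    rw [lowerSemicontinuous_iff_le_liminf]
    intro x
    refine le_trans (lintegral_mono fun y => ?_) (lintegral_liminf_le (u := nhds x) ?_)
    · have hc : Filter.Tendsto (fun z : Eu n => F y * edist z y ^ l) (nhds x)
          (nhds (F y * edist x y ^ l)) := by
        refine ENNReal.Tendsto.const_mul ?_ (Or.inr (hFt y))
        exact (ENNReal.continuous_rpow_const.comp
          (continuous_id.edist continuous_const)).tendsto x
      exact hc.liminf_eq.ge
    · intro z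
      fun_prop
  obtain ⟨x₀, h₀, hmin⟩ := LowerSemicontinuousOn.exists_isMinOn
    (s := closedBall (zo n) 1) ⟨zo n, by simp⟩ (isCompact_closedBall _ _)
    (hlsc.lowerSemicontinuousOn _)
  exact ⟨x₀, h₀, fun x hx => hmin hx⟩

/-- Corollary 2.3, reversed HLS inequality on the ball with
subcritical exponents. -/
theorem reversed_HLS_ball_subcritical
    (n : ℕ) (hn : 2 ≤ n) (α : ℝ) (hα : (n : ℝ) < α) (p t : ℝ)
    (hp0 : 0 < p) (hp : p < 2 * ((n : ℝ) - 1) / ((n : ℝ) + α - 2))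
    (ht0 : 0 < t) (ht : t < 2 * (n : ℝ) / ((n : ℝ) + α)) :
    ∃ C : ℝ, 0 < C ∧
      ∀ (f : Eu n → ℝ), (∀ y, 0 ≤ f y) → Measurable f → eLp (surf n) f p ≠ ⊤ →
        ∀ (g : Eu n → ℝ), (∀ x, 0 ≤ g x) → Measurable g → eLp (ballM n) g t ≠ ⊤ →
          ENNReal.ofReal C * eLp (surf n) f p * eLp (ballM n) g t ≤
            ∫⁻ x, ∫⁻ y,
                ENNReal.ofReal (g x) * ENNReal.ofReal (f y) *
                  ENNReal.ofReal (‖x - y‖ ^ (α - (n : ℝ)))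
              ∂surf n ∂ballM n := by
  have hn' : (2 : ℝ) ≤ n := by exact_mod_cast hn
  obtain ⟨m, hm⟩ : ∃ m : ℝ, m = (α - n) / 2 := ⟨_, rfl⟩
  have hm0 : 0 < m := by rw [hm]; linarith
  have hαn : α - n = 2 * m := by rw [hm]; ring
  have hp' : p * ((n : ℝ) - 1 + m) < (n : ℝ) - 1 := by
    rw [lt_div_iff₀ (by linarith)] at hp
    nlinarith
  have ht' : t * (n + m) < n := by
    rw [lt_div_iff₀ (by linarith)] at ht
    nlinarith
  have hp1 : p < 1 := by nlinarith
  have ht1 : t < 1 := by nlinarith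
  have hp1' : 0 < 1 - p := by linarith
  have ht1' : 0 < 1 - t := by linarith
  have hV : (volume : Measure (Eu n)) (ball 0 1) ≠ ⊤ := measure_ball_lt_top.ne
  obtain ⟨K₁, hK₁, hK₁'⟩ := aux_riesz_bound ((n : ℝ) - 1) (m * (p / (1 - p))) (by positivity)
    (by rw [← mul_div_assoc, div_lt_iff₀ hp1']; nlinarith)
    (n * 2 ^ n * volume (ball (0 : Eu n) 1))
    (ENNReal.mul_ne_top (ENNReal.mul_ne_top (by simp) (by simp)) hV)
  obtain ⟨K₂, hK₂, hK₂'⟩ := aux_riesz_bound (n : ℝ) (m * (t / (1 - t))) (by positivity)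
    (by rw [← mul_div_assoc, div_lt_iff₀ ht1']; nlinarith)
    (volume (ball (0 : Eu n) 1)) hV
  obtain ⟨L, hL⟩ : ∃ L : ℝ≥0∞, L = K₁ ^ ((1 - p) / p) * K₂ ^ ((1 - t) / t) * (2 ^ m * 2) + 1 :=
    ⟨_, rfl⟩
  have hLt : L ≠ ⊤ := by
    rw [hL]
    refine ENNReal.add_ne_top.2 ⟨ENNReal.mul_ne_top (ENNReal.mul_ne_top ?_ ?_)
      (ENNReal.mul_ne_top (by simp) (by simp)), by simp⟩
    · exact ENNReal.rpow_ne_top_of_nonneg (by positivity) hK₁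
    · exact ENNReal.rpow_ne_top_of_nonneg (by positivity) hK₂
  have hL0 : L ≠ 0 := by rw [hL]; simp
  refine ⟨L.toReal⁻¹, inv_pos.2 (ENNReal.toReal_pos hL0 hLt), ?_⟩
  intro f hf0 hf _ g hg0 hg _
  have hfm : Measurable fun y => ENNReal.ofReal (f y) := hf.ennreal_ofReal
  have hgm : Measurable fun y => ENNReal.ofReal (g y) := hg.ennreal_ofReal
  obtain ⟨x₀, hx₀, hmin⟩ := aux_min n _ hfm (fun y => ENNReal.ofReal_ne_top) (2 * m) (by positivity) (surf n)
  have hsx : ∀ s : ℝ, ∀ x : Eu n, (edist x x₀ ^ m) ^ (-s) = edist x x₀ ^ (-(m * s)) := by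
    intro s x
    rw [← ENNReal.rpow_mul]; congr 1; ring
  have hA : eLp (surf n) f p ≤ K₁ ^ ((1 - p) / p) *
      ∫⁻ y, ENNReal.ofReal (f y) * edist y x₀ ^ m ∂surf n := by
    refine aux_reverse_holder _ _ _ hfm (by fun_prop)
      (fun x => ENNReal.rpow_ne_top_of_nonneg hm0.le (edist_ne_top _ _)) p hp0 hp1 K₁ hK₁ ?_
    simp_rw [hsx]
    refine hK₁' n _ x₀ (aux_surf_univ n) (aux_surf_ball n x₀ ?_)
    rwa [← dist_eq_norm]
  have hB : eLp (ballM n) g t ≤ K₂ ^ ((1 - t) / t) *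
      ∫⁻ y, ENNReal.ofReal (g y) * edist y x₀ ^ m ∂ballM n := by
    refine aux_reverse_holder _ _ _ hgm (by fun_prop)
      (fun x => ENNReal.rpow_ne_top_of_nonneg hm0.le (edist_ne_top _ _)) t ht0 ht1 K₂ hK₂ ?_
    simp_rw [hsx]
    refine hK₂' n _ x₀ ?_ ?_
    · rw [ballM, Measure.restrict_apply_univ, Measure.addHaar_ball_center]
    · intro k
      exact (Measure.restrict_apply_le _ _).trans (aux_ball_vol n x₀ k)
  obtain ⟨A, hAdef⟩ : ∃ A, A = ∫⁻ y, ENNReal.ofReal (f y) * edist y x₀ ^ m ∂surf n := ⟨_, rfl⟩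
  obtain ⟨B, hBdef⟩ : ∃ B, B = ∫⁻ y, ENNReal.ofReal (g y) * edist y x₀ ^ m ∂ballM n := ⟨_, rfl⟩
  rw [← hAdef] at hA
  rw [← hBdef] at hB
  have hψ : ∀ x ∈ closedBall (zo n) 1, edist x x₀ ^ m * A ≤
      2 ^ m * 2 * ∫⁻ y, ENNReal.ofReal (f y) * edist x y ^ (2 * m) ∂surf n := by
    intro x hx
    calc edist x x₀ ^ m * A
        = ∫⁻ y, edist x x₀ ^ m * (ENNReal.ofReal (f y) * edist y x₀ ^ m) ∂surf n := by
          rw [hAdef, lintegral_const_mul _ (by fun_prop)]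
      _ ≤ ∫⁻ y, 2 ^ m * (ENNReal.ofReal (f y) * edist x y ^ (2 * m) +
            ENNReal.ofReal (f y) * edist x₀ y ^ (2 * m)) ∂surf n := by
          refine lintegral_mono fun y => ?_
          calc edist x x₀ ^ m * (ENNReal.ofReal (f y) * edist y x₀ ^ m)
              = ENNReal.ofReal (f y) * (edist x x₀ ^ m * edist y x₀ ^ m) := by ring
            _ ≤ ENNReal.ofReal (f y) *
                (2 ^ m * (edist x y ^ (2 * m) + edist x₀ y ^ (2 * m))) := by
                exact mul_le_mul' le_rfl (aux_kernel m hm0 x x₀ y)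
            _ = _ := by ring
      _ = 2 ^ m * (∫⁻ y, ENNReal.ofReal (f y) * edist x y ^ (2 * m) ∂surf n +
            ∫⁻ y, ENNReal.ofReal (f y) * edist x₀ y ^ (2 * m) ∂surf n) := by
          rw [lintegral_const_mul _ (by fun_prop), lintegral_add_left (by fun_prop)]
      _ ≤ 2 ^ m * (∫⁻ y, ENNReal.ofReal (f y) * edist x y ^ (2 * m) ∂surf n +
            ∫⁻ y, ENNReal.ofReal (f y) * edist x y ^ (2 * m) ∂surf n) := by
          exact mul_le_mul' le_rfl (add_le_add le_rfl (hmin x hx))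
      _ = _ := by rw [← two_mul, mul_assoc]
  have hI : ∀ x, ∫⁻ y, ENNReal.ofReal (g x) * ENNReal.ofReal (f y) *
      ENNReal.ofReal (‖x - y‖ ^ (α - (n : ℝ))) ∂surf n =
      ENNReal.ofReal (g x) * ∫⁻ y, ENNReal.ofReal (f y) * edist x y ^ (2 * m) ∂surf n := by
    intro x
    rw [← lintegral_const_mul _ (by fun_prop)]
    refine lintegral_congr fun y => ?_
    rw [hαn, edist_dist, dist_eq_norm,
      ENNReal.ofReal_rpow_of_nonneg (norm_nonneg _) (by positivity), mul_assoc]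
  simp_rw [hI]
  obtain ⟨J, hJ⟩ : ∃ J, J = ∫⁻ x, ENNReal.ofReal (g x) *
    ∫⁻ y, ENNReal.ofReal (f y) * edist x y ^ (2 * m) ∂surf n ∂ballM n := ⟨_, rfl⟩
  rw [← hJ]
  have hAB : A * B ≤ 2 ^ m * 2 * J := by
    have h2t : (2 : ℝ≥0∞) ^ m * 2 ≠ ⊤ := ENNReal.mul_ne_top (by simp) (by simp)
    rw [hBdef, hJ, ← lintegral_const_mul _ (by fun_prop), ← lintegral_const_mul' _ _ h2t]
    refine lintegral_mono_ae ?_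
    rw [ballM]
    filter_upwards [ae_restrict_mem measurableSet_ball] with x hx
    calc A * (ENNReal.ofReal (g x) * edist x x₀ ^ m)
        = ENNReal.ofReal (g x) * (edist x x₀ ^ m * A) := by ring
      _ ≤ ENNReal.ofReal (g x) * (2 ^ m * 2 *
            ∫⁻ y, ENNReal.ofReal (f y) * edist x y ^ (2 * m) ∂surf n) := by
          exact mul_le_mul' le_rfl (hψ x (ball_subset_closedBall hx))
      _ = _ := by ring
  have hfin : eLp (surf n) f p * eLp (ballM n) g t ≤ L * J := by
    calc eLp (surf n) f p * eLp (ballM n) g t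
        ≤ (K₁ ^ ((1 - p) / p) * A) * (K₂ ^ ((1 - t) / t) * B) := by gcongr
      _ = K₁ ^ ((1 - p) / p) * K₂ ^ ((1 - t) / t) * (A * B) := by ring
      _ ≤ K₁ ^ ((1 - p) / p) * K₂ ^ ((1 - t) / t) * (2 ^ m * 2 * J) := by gcongr
      _ = K₁ ^ ((1 - p) / p) * K₂ ^ ((1 - t) / t) * (2 ^ m * 2) * J := by ring
      _ ≤ L * J := by
          gcongr
          rw [hL]
          exact le_self_add
  have hC : ENNReal.ofReal (L.toReal⁻¹) = L⁻¹ := by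
    rw [ENNReal.ofReal_inv_of_pos (ENNReal.toReal_pos hL0 hLt), ENNReal.ofReal_toReal hLt]
  rw [hC, mul_assoc]
  calc L⁻¹ * (eLp (surf n) f p * eLp (ballM n) g t) ≤ L⁻¹ * (L * J) := by gcongr
    _ = J := by rw [← mul_assoc, ENNReal.inv_mul_cancel hL0 hLt, one_mul]
end
end
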